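/- arXiv:2312.06414 — 3 statements merged into one kernel-verified Lean document; each statement's English description precedes it below -/
import Mathlib

section
/- Let 1<p<∞, let 𝒟=𝒟¹×𝒟² be a product dyadic grid in ℝ^n×ℝ^m, let U,V be biparameter d×d-matrix valued 𝒟-dyadic A_p weights, and let B∈L¹_loc(ℝ^{n+m};M_d(ℂ)). Then ‖B‖_{bmõ_𝒟(U,V,p)} ≥ c·max( esssup_{x2∈ℝ^m} ‖B_{x2}‖_{B̃MO_{𝒟¹}(U_{x2},V_{x2},p)}, esssup_{x1∈ℝ^n} ‖B_{x1}‖_{B̃MO_{𝒟²}(U_{x1},V_{x1},p)} ), where the constant c>0 depends only on p and d. -/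
open MeasureTheory Filter
open scoped ENNReal ComplexOrder

noncomputable section

namespace TwoWeightBMO

/-- Euclidean norm of a vector in `ℂ^d`. -/
def vNorm (d : ℕ) (v : Fin d → ℂ) : ℝ := ‖(WithLp.equiv 2 (Fin d → ℂ)).symm v‖

/-- Operator norm (largest singular value) of a `d × d` complex matrix. -/
def mNorm (d : ℕ) (A : Matrix (Fin d) (Fin d) ℂ) : ℝ :=
  ‖Matrix.toEuclideanCLM (𝕜 := ℂ) (n := Fin d) A‖

/-- Real power of a matrix, via the continuous functional calculus
(for a positive definite matrix this is the usual power `A^t`). -/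
def matRpow {d : ℕ} (A : Matrix (Fin d) (Fin d) ℂ) (t : ℝ) : Matrix (Fin d) (Fin d) ℂ :=
  cfc (fun x : ℝ => x ^ t) A

/-- Hölder conjugate exponent `p' = p/(p-1)`. -/
def pconj (p : ℝ) : ℝ := p / (p - 1)

/-- Entrywise average of a matrix-valued function over a set. -/
def matAvg {X : Type*} [MeasureSpace X] {d : ℕ} (B : X → Matrix (Fin d) (Fin d) ℂ)
    (R : Set X) : Matrix (Fin d) (Fin d) ℂ :=
  Matrix.of fun i j => ⨍ x in R, B x i j

/-- `M` is a reducing operator of `W` over `E` with respect to the exponent `p`. -/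
def IsReducing {X : Type*} [MeasureSpace X] {d : ℕ} (p : ℝ)
    (W : X → Matrix (Fin d) (Fin d) ℂ) (E : Set X) (M : Matrix (Fin d) (Fin d) ℂ) : Prop :=
  M.PosDef ∧ ∀ e : Fin d → ℂ,
    (⨍ x in E, vNorm d ((matRpow (W x) (1 / p)).mulVec e) ^ p) ^ (1 / p)
        ≤ vNorm d (M.mulVec e) ∧
      vNorm d (M.mulVec e)
        ≤ Real.sqrt d * (⨍ x in E, vNorm d ((matRpow (W x) (1 / p)).mulVec e) ^ p) ^ (1 / p)

/-- The `A_p` quantity of a matrix weight `W` over a set `R`: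
`⨍_R (⨍_R |W(x)^{1/p} W(y)^{-1/p}|^{p'} dy)^{p/p'} dx`. -/
def apQ {X : Type*} [MeasureSpace X] {d : ℕ} (p : ℝ)
    (W : X → Matrix (Fin d) (Fin d) ℂ) (R : Set X) : ℝ :=
  ⨍ x in R, (⨍ y in R,
      mNorm d (matRpow (W x) (1 / p) * matRpow (W y) (-(1 / p))) ^ pconj p) ^ (p / pconj p)

/-- Local integrability (`L¹_loc`) of a matrix-valued function. -/
def LocIntMat {X : Type*} [MeasureSpace X] [TopologicalSpace X] {d : ℕ}
    (B : X → Matrix (Fin d) (Fin d) ℂ) : Prop :=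
  (∀ i j, AEStronglyMeasurable (fun x => B x i j) volume) ∧
    LocallyIntegrable (fun x => mNorm d (B x)) volume

/-- `W` is a matrix `A_p` weight relative to the family of sets `Fam`, with `A_p`
characteristic bounded by `C`. -/
def IsApWeight {X : Type*} [MeasureSpace X] [TopologicalSpace X] {d : ℕ} (p C : ℝ)
    (W : X → Matrix (Fin d) (Fin d) ℂ) (Fam : Set (Set X)) : Prop :=
  (∀ᵐ x, (W x).PosDef) ∧ LocIntMat W ∧ ∀ R ∈ Fam, apQ p W R ≤ C

/-- The `A_p` characteristic of `W` relative to the family `Fam`, as a value in `ℝ≥0∞`. -/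
def apCharE {X : Type*} [MeasureSpace X] {d : ℕ} (p : ℝ)
    (W : X → Matrix (Fin d) (Fin d) ℂ) (Fam : Set (Set X)) : ℝ≥0∞ :=
  ⨆ R ∈ Fam, ENNReal.ofReal (apQ p W R)

/-- An axis-parallel cube in `ℝ^n` (product of left-closed right-open intervals of equal
positive length). -/
def IsCube {n : ℕ} (Q : Set (Fin n → ℝ)) : Prop :=
  ∃ (a : Fin n → ℝ) (h : ℝ), 0 < h ∧ Q = Set.univ.pi fun i => Set.Ico (a i) (a i + h)

/-- An axis-parallel rectangle in `ℝ^n × ℝ^m`, i.e. a product of two cubes. -/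
def IsRectangle {n m : ℕ} (R : Set ((Fin n → ℝ) × (Fin m → ℝ))) : Prop :=
  ∃ Q₁ Q₂, IsCube Q₁ ∧ IsCube Q₂ ∧ R = Q₁ ×ˢ Q₂

/-- The two-matrix weighted BMO norm over the family `Fam`, with a given choice `RU` of
reducing operators (of the weight `U`, w.r.t. exponent `p`):
`sup_R (⨍_R |V(x)^{1/p}(B(x) − ⟨B⟩_R) 𝒰_R^{-1}|^p dx)^{1/p}`, valued in `ℝ≥0∞`. -/
def bmoS {X : Type*} [MeasureSpace X] {d : ℕ} (p : ℝ)
    (V B : X → Matrix (Fin d) (Fin d) ℂ) (RU : Set X → Matrix (Fin d) (Fin d) ℂ)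
    (Fam : Set (Set X)) : ℝ≥0∞ :=
  ⨆ R ∈ Fam, ENNReal.ofReal
    ((⨍ x in R, mNorm d (matRpow (V x) (1 / p) * (B x - matAvg B R) * (RU R)⁻¹) ^ p) ^ (1 / p))

/-- The variant norm `sup_R ⨍_R |𝒱_R (B(x) − ⟨B⟩_R) 𝒰_R^{-1}| dx`, valued in `ℝ≥0∞`. -/
def bmoTS {X : Type*} [MeasureSpace X] {d : ℕ}
    (B : X → Matrix (Fin d) (Fin d) ℂ) (RU RV : Set X → Matrix (Fin d) (Fin d) ℂ)
    (Fam : Set (Set X)) : ℝ≥0∞ :=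
  ⨆ R ∈ Fam, ENNReal.ofReal (⨍ x in R, mNorm d (RV R * (B x - matAvg B R) * (RU R)⁻¹))

/-- The norm `bmo¹`:
`sup_R (⨍_R (⨍_R |V(x)^{1/p}(B(x)−B(y))U(y)^{-1/p}|^{p'} dy)^{p/p'} dx)^{1/p}`. -/
def bmo1S {X : Type*} [MeasureSpace X] {d : ℕ} (p : ℝ)
    (U V B : X → Matrix (Fin d) (Fin d) ℂ) (Fam : Set (Set X)) : ℝ≥0∞ :=
  ⨆ R ∈ Fam, ENNReal.ofReal
    ((⨍ x in R, (⨍ y in R,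
        mNorm d (matRpow (V x) (1 / p) * (B x - B y) * matRpow (U y) (-(1 / p))) ^ pconj p)
          ^ (p / pconj p)) ^ (1 / p))

/-- The norm `bmo²`:
`sup_R (⨍_R (⨍_R |V(x)^{1/p}(B(x)−B(y))U(y)^{-1/p}|^{p} dx)^{p'/p} dy)^{1/p'}`. -/
def bmo2S {X : Type*} [MeasureSpace X] {d : ℕ} (p : ℝ)
    (U V B : X → Matrix (Fin d) (Fin d) ℂ) (Fam : Set (Set X)) : ℝ≥0∞ :=
  ⨆ R ∈ Fam, ENNReal.ofReal
    ((⨍ y in R, (⨍ x in R,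
        mNorm d (matRpow (V x) (1 / p) * (B x - B y) * matRpow (U y) (-(1 / p))) ^ p)
          ^ (pconj p / p)) ^ (1 / pconj p))

/-- A dyadic grid in `ℝ`, presented by its generations: `D k` is the `k`-th generation,
a partition of `ℝ` into left-closed right-open intervals of length `2^{-k}`, each member of
generation `k` being the union of exactly two members of generation `k+1`. -/
def IsDyadicGridR (D : ℤ → Set (Set ℝ)) : Prop :=
  ∀ k : ℤ,
    (∀ I ∈ D k, ∃ a : ℝ, I = Set.Ico a (a + 2 ^ (-k))) ∧
    (∀ x : ℝ, ∃! I, I ∈ D k ∧ x ∈ I) ∧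
    (∀ I ∈ D k, ∃ I₁ ∈ D (k + 1), ∃ I₂ ∈ D (k + 1), I₁ ≠ I₂ ∧ I = I₁ ∪ I₂)

/-- A dyadic grid in `ℝ^n`: the cubes of generation `k` are the products of generation-`k`
intervals of `n` fixed dyadic grids in `ℝ`. -/
def IsDyadicGridRn {n : ℕ} (G : Set (Set (Fin n → ℝ))) : Prop :=
  ∃ D : Fin n → ℤ → Set (Set ℝ), (∀ i, IsDyadicGridR (D i)) ∧
    G = {Q | ∃ (k : ℤ) (I : Fin n → Set ℝ), (∀ i, I i ∈ D i k) ∧ Q = Set.univ.pi I}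

/-- The family of rectangles generated by two families of cubes. -/
def prodFam {n m : ℕ} (G₁ : Set (Set (Fin n → ℝ))) (G₂ : Set (Set (Fin m → ℝ))) :
    Set (Set ((Fin n → ℝ) × (Fin m → ℝ))) :=
  {R | ∃ Q₁ ∈ G₁, ∃ Q₂ ∈ G₂, R = Q₁ ×ˢ Q₂}

/-- A product dyadic grid `𝒟 = 𝒟¹ × 𝒟²` in `ℝ^n × ℝ^m`. -/
def IsProductDyadicGrid {n m : ℕ} (G₁ : Set (Set (Fin n → ℝ))) (G₂ : Set (Set (Fin m → ℝ)))
    (G : Set (Set ((Fin n → ℝ) × (Fin m → ℝ)))) : Prop :=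
  IsDyadicGridRn G₁ ∧ IsDyadicGridRn G₂ ∧ G = prodFam G₁ G₂

/-- Euclidean norm of a vector in `ℝ^n`. -/
def eN {n : ℕ} (v : Fin n → ℝ) : ℝ := Real.sqrt (∑ i, v i ^ 2)

/-- The (scalar) kernel of the double Riesz transform `R^1_j R^2_k` on `ℝ^n × ℝ^m`. -/
def rieszKernel (n m : ℕ) (j : Fin n) (k : Fin m)
    (x y : (Fin n → ℝ) × (Fin m → ℝ)) : ℝ :=
  ((x.1 j - y.1 j) / eN (x.1 - y.1) ^ (n + 1)) * ((x.2 k - y.2 k) / eN (x.2 - y.2) ^ (m + 1))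

/-- Euclidean pairing `⟨v, w⟩ = ∑ v_i conj(w_i)` on `ℂ^d`. -/
def pair (d : ℕ) (v w : Fin d → ℂ) : ℂ := ∑ i, v i * star (w i)

/-- `(∫ |f|^p)^{1/p}` for a `ℂ^d`-valued function, valued in `ℝ≥0∞`. -/
def eVLp {X : Type*} [MeasureSpace X] {d : ℕ} (p : ℝ) (f : X → Fin d → ℂ) : ℝ≥0∞ :=
  (∫⁻ x, ENNReal.ofReal (vNorm d (f x) ^ p)) ^ (1 / p)

/-- The `L^p(W)` norm `(∫ |W(x)^{1/p} f(x)|^p dx)^{1/p}`, valued in `ℝ≥0∞`. -/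
def eWLp {X : Type*} [MeasureSpace X] {d : ℕ} (p : ℝ)
    (W : X → Matrix (Fin d) (Fin d) ℂ) (f : X → Fin d → ℂ) : ℝ≥0∞ :=
  eVLp p fun x => (matRpow (W x) (1 / p)).mulVec (f x)

/-- The Muckenhoupt dual weight `W' = W^{-p'/p}` of `W` (w.r.t. the exponent `p`). -/
def dualW {X : Type*} {d : ℕ} (p : ℝ) (W : X → Matrix (Fin d) (Fin d) ℂ) :
    X → Matrix (Fin d) (Fin d) ℂ :=
  fun x => matRpow (W x) (-(pconj p / p))

/-- Fourier transform `ρ̂(t) = ∫ ρ(x) e^{-i⟨t,x⟩} dx` on `ℝ^n × ℝ^m`. -/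
def ft {n m : ℕ} (ρ : ((Fin n → ℝ) × (Fin m → ℝ)) → ℂ)
    (t : (Fin n → ℝ) × (Fin m → ℝ)) : ℂ :=
  ∫ x, ρ x * Complex.exp (-Complex.I * (((∑ i, t.1 i * x.1 i) + ∑ i, t.2 i * x.2 i : ℝ) : ℂ))

/-- The supports of `f` and `g` are at positive distance. -/
def SepSupp {X : Type*} [PseudoMetricSpace X] {E F : Type*} [Zero E] [Zero F]
    (f : X → E) (g : X → F) : Prop :=
  ∃ δ : ℝ, 0 < δ ∧ ∀ x ∈ Function.support f, ∀ y ∈ Function.support g, δ ≤ dist x y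

/-- Matrices with Gaussian-rational entries (`M_d(ℚ + iℚ)`). -/
def GaussRat {d : ℕ} (A : Matrix (Fin d) (Fin d) ℂ) : Prop :=
  ∀ i j, ∃ q r : ℚ, A i j = (q : ℂ) + (r : ℂ) * Complex.I

end TwoWeightBMO

namespace TwoWeightBMO

section Auxiliary

open Set Topology ProbabilityTheory

section Grid

lemma IsDyadicGridR.countable {D : ℤ → Set (Set ℝ)} (hD : IsDyadicGridR D) (k : ℤ) :
    (D k).Countable := by
  choose J hJ using fun x : ℝ => ((hD k).2.1 x).exists
  refine (countable_range fun q : ℚ => J q).mono fun I hI => ?_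
  obtain ⟨a, rfl⟩ := (hD k).1 I hI
  obtain ⟨q, hq₁, hq₂⟩ := exists_rat_btwn (show a < a + 2 ^ (-k) by simp; positivity)
  exact ⟨q, ((hD k).2.1 q).unique (hJ q) ⟨hI, hq₁.le, hq₂⟩⟩

lemma IsDyadicGridRn.countable {n : ℕ} {G : Set (Set (Fin n → ℝ))} (hG : IsDyadicGridRn G) :
    G.Countable := by
  obtain ⟨D, hD, rfl⟩ := hG
  have h : (⋃ k : ℤ, (fun I : Fin n → Set ℝ => univ.pi I) '' {I | ∀ i, I i ∈ D i k}).Countable :=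
    countable_iUnion fun k => ((countable_pi fun i => (hD i).countable k)).image _
  refine h.mono ?_
  rintro Q ⟨k, I, hI, rfl⟩
  exact mem_iUnion.2 ⟨k, I, hI, rfl⟩

lemma IsDyadicGridRn.exists_eq {n : ℕ} {G : Set (Set (Fin n → ℝ))} (hG : IsDyadicGridRn G)
    {Q : Set (Fin n → ℝ)} (hQ : Q ∈ G) :
    ∃ (k : ℤ) (a : Fin n → ℝ), Q = univ.pi fun i => Ico (a i) (a i + 2 ^ (-k)) := by
  obtain ⟨D, hD, rfl⟩ := hG
  obtain ⟨k, I, hI, rfl⟩ := hQ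
  choose a ha using fun i => (hD i k).1 (I i) (hI i)
  exact ⟨k, a, by simp only [← ha]⟩

lemma IsDyadicGridRn.measurableSet {n : ℕ} {G : Set (Set (Fin n → ℝ))} (hG : IsDyadicGridRn G)
    {Q : Set (Fin n → ℝ)} (hQ : Q ∈ G) : MeasurableSet Q := by
  obtain ⟨k, a, rfl⟩ := hG.exists_eq hQ
  exact MeasurableSet.univ_pi fun i => measurableSet_Ico

lemma IsDyadicGridRn.volume_ne_zero {n : ℕ} {G : Set (Set (Fin n → ℝ))} (hG : IsDyadicGridRn G)
    {Q : Set (Fin n → ℝ)} (hQ : Q ∈ G) : volume Q ≠ 0 := by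
  obtain ⟨k, a, rfl⟩ := hG.exists_eq hQ
  rw [Real.volume_pi_Ico]
  refine Finset.prod_ne_zero_iff.2 fun i _ => ?_
  simp only [add_sub_cancel_left, ne_eq, ENNReal.ofReal_eq_zero, not_le]
  positivity

lemma IsDyadicGridRn.exists_isCompact {n : ℕ} {G : Set (Set (Fin n → ℝ))}
    (hG : IsDyadicGridRn G) {Q : Set (Fin n → ℝ)} (hQ : Q ∈ G) : ∃ K, IsCompact K ∧ Q ⊆ K := by
  obtain ⟨k, a, rfl⟩ := hG.exists_eq hQ
  exact ⟨univ.pi fun i => Icc (a i) (a i + 2 ^ (-k)), isCompact_univ_pi fun i => isCompact_Icc,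
    pi_mono fun i _ => Ico_subset_Icc_self⟩

lemma IsDyadicGridRn.volume_ne_top {n : ℕ} {G : Set (Set (Fin n → ℝ))} (hG : IsDyadicGridRn G)
    {Q : Set (Fin n → ℝ)} (hQ : Q ∈ G) : volume Q ≠ ∞ := by
  obtain ⟨K, hK, hQK⟩ := hG.exists_isCompact hQ
  exact measure_ne_top_of_subset hQK hK.measure_ne_top

lemma IsDyadicGridRn.isProbabilityMeasure_cond {n : ℕ} {G : Set (Set (Fin n → ℝ))}
    (hG : IsDyadicGridRn G) {Q : Set (Fin n → ℝ)} (hQ : Q ∈ G) :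
    IsProbabilityMeasure (cond volume Q) :=
  cond_isProbabilityMeasure_of_finite (hG.volume_ne_zero hQ) (hG.volume_ne_top hQ)

lemma integrable_cond_iff {X F : Type*} [MeasurableSpace X] [NormedAddCommGroup F]
    {μ : Measure X} {s : Set X} (h0 : μ s ≠ 0) (h1 : μ s ≠ ∞) {f : X → F} :
    Integrable f (cond μ s) ↔ IntegrableOn f s μ :=
  integrable_smul_measure (ENNReal.inv_ne_zero.2 h1) (ENNReal.inv_ne_top.2 h0)

/-- The intervals of a dyadic grid containing a given point decrease along the generations. -/
lemma IsDyadicGridR.subset_of_mem {D : ℤ → Set (Set ℝ)} (hD : IsDyadicGridR D) {k : ℤ} {x : ℝ}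
    {I J : Set ℝ} (hI : I ∈ D k) (hxI : x ∈ I) (hJ : J ∈ D (k + 1)) (hxJ : x ∈ J) : J ⊆ I := by
  obtain ⟨I₁, h₁, I₂, h₂, -, rfl⟩ := (hD k).2.2 I hI
  rcases hxI with hx | hx
  · rw [((hD (k + 1)).2.1 x).unique ⟨hJ, hxJ⟩ ⟨h₁, hx⟩]
    exact subset_union_left
  · rw [((hD (k + 1)).2.1 x).unique ⟨hJ, hxJ⟩ ⟨h₂, hx⟩]
    exact subset_union_right

/-- Lebesgue differentiation along the cubes of a dyadic grid. -/
lemma IsDyadicGridRn.exists_cubes {m : ℕ} {G : Set (Set (Fin m → ℝ))} (hG : IsDyadicGridRn G) :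
    ∃ P : ℕ → (Fin m → ℝ) → Set (Fin m → ℝ), (∀ k x, P k x ∈ G) ∧ (∀ k x, x ∈ P k x) ∧
      ∀ F : (Fin m → ℝ) → ℝ, (∀ Q ∈ G, IntegrableOn F Q) →
        ∀ᵐ x, Tendsto (fun k => ∫ y, F y ∂(cond volume (P k x))) atTop (𝓝 (F x)) := by
  have hG' := hG
  obtain ⟨D, hD, rfl⟩ := hG
  choose J hJ using fun (i : Fin m) (k : ℕ) (t : ℝ) => ((hD i k).2.1 t).exists
  choose a ha using fun i k t => (hD i (k : ℕ)).1 (J i k t) (hJ i k t).1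
  let P : ℕ → (Fin m → ℝ) → Set (Fin m → ℝ) := fun k x => univ.pi fun i => J i k (x i)
  have hPG : ∀ k x, P k x ∈ {Q | ∃ (k : ℤ) (I : Fin m → Set ℝ), (∀ i, I i ∈ D i k) ∧
      Q = univ.pi I} := fun k x => ⟨k, fun i => J i k (x i), fun i => (hJ i k (x i)).1, rfl⟩
  have hmem : ∀ k x, x ∈ P k x := fun k x i _ => (hJ i k (x i)).2
  have hanti : ∀ x, Antitone fun k => P k x := fun x => antitone_nat_of_succ_le fun k =>
    pi_mono fun i _ => (hD i).subset_of_mem (hJ i k (x i)).1 (hJ i k (x i)).2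
      (by exact_mod_cast (hJ i (k + 1) (x i)).1) (hJ i (k + 1) (x i)).2
  refine ⟨P, hPG, hmem, fun F hF => ?_⟩
  have key : ∀ C ∈ {Q | ∃ (k : ℤ) (I : Fin m → Set ℝ), (∀ i, I i ∈ D i k) ∧ Q = univ.pi I},
      ∀ᵐ x, P 0 x = C →
        Tendsto (fun k => ∫ y, F y ∂(cond volume (P k x))) atTop (𝓝 (F x)) := by
    intro C hC
    have hCm := hG'.measurableSet hC
    have hint : Integrable (C.indicator F) := (hF C hC).integrable_indicator hCm
    filter_upwards [IsUnifLocDoublingMeasure.ae_tendsto_average volume hint.locallyIntegrable 1]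
      with x hx hxC
    have hxF : C.indicator F x = F x := indicator_of_mem (hxC ▸ hmem 0 x) F
    let δ : ℕ → ℝ := fun k => 2 ^ (-(k : ℤ)) / 2
    have hδ : Tendsto δ atTop (𝓝[>] 0) := by
      refine tendsto_nhdsWithin_iff.2 ⟨?_, Eventually.of_forall fun k => ?_⟩
      · have := (tendsto_pow_atTop_nhds_zero_of_lt_one (r := (2 : ℝ)⁻¹) (by norm_num)
          (by norm_num)).div_const 2
        simpa [δ] using this
      · simp only [δ, mem_Ioi]; positivity
    have hball : ∀ k, P k x =ᵐ[volume]
        Metric.closedBall (fun i => a i k (x i) + δ k) (δ k) := by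
      intro k
      have hδk : 0 ≤ δ k := by simp only [δ]; positivity
      have h1 : P k x = univ.pi fun i => Ico (a i k (x i)) (a i k (x i) + 2 ^ (-(k : ℤ))) := by
        simp only [P, ← ha]
      have h2 : Metric.closedBall (fun i => a i k (x i) + δ k) (δ k) =
          Icc (fun i => a i k (x i)) (fun i => a i k (x i) + 2 ^ (-(k : ℤ))) := by
        rw [closedBall_pi _ hδk, ← pi_univ_Icc]
        refine pi_congr rfl fun i _ => ?_
        rw [Real.closedBall_eq_Icc]
        congr 1 <;> simp only [δ] <;> ring
      rw [h1, h2]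
      exact Measure.univ_pi_Ico_ae_eq_Icc
    have hxb : ∀ᶠ k in atTop, x ∈ Metric.closedBall (fun i => a i k (x i) + δ k) (1 * δ k) := by
      refine Eventually.of_forall fun k => ?_
      have hδk : 0 ≤ δ k := by simp only [δ]; positivity
      rw [one_mul, closedBall_pi _ hδk]
      intro i _
      have h := (hJ i k (x i)).2
      rw [ha i k (x i)] at h
      change x i ∈ Metric.closedBall (a i k (x i) + δ k) (δ k)
      rw [Real.closedBall_eq_Icc]
      simp only [δ, mem_Icc, mem_Ico] at h ⊢
      constructor <;> linarith [h.1, h.2]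
    have := hx _ δ hδ hxb
    rw [hxF] at this
    refine this.congr fun k => ?_
    rw [← setAverage_congr (hball k), setAverage_eq']
    refine integral_congr_ae ?_
    refine Measure.ae_smul_measure ?_ _
    filter_upwards [ae_restrict_mem (hG'.measurableSet (hPG k x))] with y hy
    exact indicator_of_mem (hxC ▸ hanti x (Nat.zero_le k) hy) F
  filter_upwards [(ae_ball_iff hG'.countable).2 key] with x hx
  exact hx _ (hPG 0 x) rfl

end Grid

section Differentiation

lemma cond_prod_cond {α β : Type*} [MeasureSpace α] [MeasureSpace β]
    [SigmaFinite (volume : Measure α)] [SigmaFinite (volume : Measure β)] {s : Set α} {t : Set β}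
    (hs : volume s ≠ ∞) (ht : volume t ≠ ∞) :
    cond volume (s ×ˢ t) = (cond volume s).prod (cond (volume : Measure β) t) := by
  simp only [ProbabilityTheory.cond, Measure.volume_eq_prod, Measure.prod_prod]
  rw [Measure.prod_smul_left, Measure.prod_smul_right, smul_smul, Measure.prod_restrict,
    ENNReal.mul_inv (Or.inr ht) (Or.inl hs)]

lemma integrable_cond_prod_restrict {α β F : Type*} [MeasurableSpace α] [MeasurableSpace β]
    [NormedAddCommGroup F] {μ : Measure α} {ν : Measure β} [SFinite μ] [SFinite ν] {s : Set α}
    {t : Set β} (hs : μ s ≠ 0) {f : α × β → F} (hf : IntegrableOn f (s ×ˢ t) (μ.prod ν)) :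
    Integrable f ((ProbabilityTheory.cond μ s).prod (ν.restrict t)) := by
  rw [ProbabilityTheory.cond, Measure.prod_smul_left, Measure.prod_restrict]
  exact hf.integrable.smul_measure (ENNReal.inv_ne_top.2 hs)

/-- Lebesgue differentiation, in the second variable, of a function of two variables viewed as
an `L¹`-valued function of the second variable. -/
lemma ae_tendsto_integral_norm_sub_slice {α β E : Type*} [MeasurableSpace α] [MeasureSpace β]
    [SigmaFinite (volume : Measure β)] [NormedAddCommGroup E] [TopologicalSpace.SeparableSpace E]
    {μ : Measure α} [IsProbabilityMeasure μ] [IsSeparable μ] {G : Set (Set β)}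
    (hGc : G.Countable) (hGm : ∀ C ∈ G, MeasurableSet C) (hG0 : ∀ C ∈ G, volume C ≠ 0)
    (hGt : ∀ C ∈ G, volume C ≠ ∞) {P : ℕ → β → Set β} (hPG : ∀ k y, P k y ∈ G)
    (hPm : ∀ k y, y ∈ P k y)
    (hdiff : ∀ F : β → ℝ, (∀ C ∈ G, IntegrableOn F C) →
      ∀ᵐ y, Tendsto (fun k => ∫ t, F t ∂(cond volume (P k y))) atTop (𝓝 (F y)))
    {f : α × β → E} (hf : ∀ C ∈ G, Integrable f (μ.prod (volume.restrict C))) :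
    ∀ᵐ y, Integrable (fun z => f (z, y)) μ ∧
      Tendsto (fun k => ∫ z, ‖f z - f (z.1, y)‖ ∂(μ.prod (cond volume (P k y)))) atTop (𝓝 0) := by
  have hint : ∀ᵐ y : β, Integrable (fun z => f (z, y)) μ := by
    have : ∀ C ∈ G, ∀ᵐ y : β, y ∈ C → Integrable (fun z => f (z, y)) μ := fun C hC =>
      (ae_restrict_iff' (hGm C hC)).1 (hf C hC).prod_left_ae
    filter_upwards [(ae_ball_iff hGc).2 this] with y hy
    exact hy _ (hPG 0 y) (hPm 0 y)
  have : Fact ((1 : ℝ≥0∞) ≠ ∞) := ⟨ENNReal.one_ne_top⟩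
  let D := TopologicalSpace.denseSeq (Lp E 1 μ)
  have hDi : ∀ j, Integrable (D j) μ := fun j => L1.integrable_coeFn _
  have hsub : ∀ j, ∀ C ∈ G,
      Integrable (fun z : α × β => ‖f z - D j z.1‖) (μ.prod (volume.restrict C)) := by
    intro j C hC
    have : IsFiniteMeasure ((volume : Measure β).restrict C) :=
      ⟨by simpa using (hGt C hC).lt_top⟩
    exact ((hf C hC).sub ((hDi j).comp_fst _)).norm
  have hD : ∀ j, ∀ᵐ y, Tendsto (fun k => ∫ t, (∫ z, ‖f (z, t) - D j z‖ ∂μ)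
      ∂(cond volume (P k y))) atTop (𝓝 (∫ z, ‖f (z, y) - D j z‖ ∂μ)) := by
    intro j
    exact hdiff _ fun C hC => (hsub j C hC).integral_prod_right
  filter_upwards [hint, ae_all_iff.2 hD] with y hy hDy
  refine ⟨hy, Metric.tendsto_atTop.2 fun ε hε => ?_⟩
  obtain ⟨j, hj⟩ := (TopologicalSpace.denseRange_denseSeq (Lp E 1 μ)).exists_dist_lt hy.toL1
    (show 0 < ε / 3 by positivity)
  have hjy : ∫ z, ‖f (z, y) - D j z‖ ∂μ < ε / 3 := by
    rw [dist_eq_norm, L1.norm_eq_integral_norm] at hj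
    refine lt_of_eq_of_lt (integral_congr_ae ?_) hj
    filter_upwards [Lp.coeFn_sub hy.toL1 (D j), hy.coeFn_toL1] with z h1 h2
    rw [h1, Pi.sub_apply, h2]
  obtain ⟨N, hN⟩ := eventually_atTop.1 ((tendsto_order.1 (hDy j)).2 _
    (show _ < (∫ z, ‖f (z, y) - D j z‖ ∂μ) + ε / 3 by linarith))
  refine ⟨N, fun k hk => ?_⟩
  have hC := hPG k y
  have : IsProbabilityMeasure (cond (volume : Measure β) (P k y)) :=
    cond_isProbabilityMeasure_of_finite (hG0 _ hC) (hGt _ hC)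
  have hprod : ∀ {g : α × β → ℝ}, Integrable g (μ.prod (volume.restrict (P k y))) →
      Integrable g (μ.prod (cond volume (P k y))) := by
    intro g hg
    rw [ProbabilityTheory.cond, Measure.prod_smul_right]
    exact hg.smul_measure (ENNReal.inv_ne_top.2 (hG0 _ hC))
  have hi1 := hprod (hsub j _ hC)
  have hi2 : Integrable (fun z : α × β => ‖f (z.1, y) - D j z.1‖)
      (μ.prod (cond volume (P k y))) := (hy.sub (hDi j)).norm.comp_fst _
  have h1 : ∫ z, ‖f z - D j z.1‖ ∂(μ.prod (cond volume (P k y))) =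
      ∫ t, (∫ z, ‖f (z, t) - D j z‖ ∂μ) ∂(cond volume (P k y)) := integral_prod_symm _ hi1
  have h2 : ∫ z, ‖f (z.1, y) - D j z.1‖ ∂(μ.prod (cond volume (P k y))) =
      ∫ z, ‖f (z, y) - D j z‖ ∂μ := by
    rw [integral_fun_fst (fun z => ‖f (z, y) - D j z‖)]
    simp
  have h3 : ∫ z, ‖f z - f (z.1, y)‖ ∂(μ.prod (cond volume (P k y))) ≤
      ∫ z, (‖f z - D j z.1‖ + ‖f (z.1, y) - D j z.1‖) ∂(μ.prod (cond volume (P k y))) := by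
    refine integral_mono_of_nonneg (Eventually.of_forall fun _ => norm_nonneg _) (hi1.add hi2)
      (Eventually.of_forall fun z => ?_)
    dsimp only
    rw [norm_sub_rev (f (z.1, y))]
    exact norm_sub_le_norm_sub_add_norm_sub _ _ _
  rw [integral_add hi1 hi2, h1, h2] at h3
  rw [Real.dist_eq, sub_zero, abs_of_nonneg (integral_nonneg fun _ => norm_nonneg _)]
  linarith [hN k hk]

lemma integral_norm_mul_sub_average_mul_le {α β A : Type*} [MeasurableSpace α]
    [MeasurableSpace β] [NormedRing A] [NormedSpace ℝ A] [CompleteSpace A] {μ : Measure α}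
    {ν : Measure β} [IsProbabilityMeasure μ] [IsProbabilityMeasure ν] {f : α × β → A} {h : α → A}
    (hf : Integrable f (μ.prod ν)) (hh : Integrable h μ) (V W : A) :
    ∫ z, ‖V * (h z - ∫ t, h t ∂μ) * W‖ ∂μ ≤
      ∫ z, ‖V * (f z - ∫ t, f t ∂(μ.prod ν)) * W‖ ∂(μ.prod ν) +
        2 * ‖V‖ * ‖W‖ * ∫ z, ‖f z - h z.1‖ ∂(μ.prod ν) := by
  set a := ∫ t, h t ∂μ
  set b := ∫ t, f t ∂(μ.prod ν)
  set ε := ∫ z, ‖f z - h z.1‖ ∂(μ.prod ν)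
  have hh' : Integrable (fun z : α × β => h z.1) (μ.prod ν) := hh.comp_fst ν
  have ha : a = ∫ z : α × β, h z.1 ∂(μ.prod ν) := by rw [integral_fun_fst]; simp [a]
  have hba : ‖b - a‖ ≤ ε := by
    rw [ha, ← integral_sub hf hh']
    exact norm_integral_le_integral_norm _
  have hmul : ∀ X : A, ‖V * X * W‖ ≤ ‖V‖ * ‖W‖ * ‖X‖ := fun X => by
    calc ‖V * X * W‖ ≤ ‖V‖ * ‖X‖ * ‖W‖ :=
          (norm_mul_le _ _).trans (mul_le_mul_of_nonneg_right (norm_mul_le _ _) (norm_nonneg _))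
      _ = _ := by ring
  have hi1 : Integrable (fun z => ‖V * (f z - b) * W‖) (μ.prod ν) :=
    (((hf.sub (integrable_const b)).const_mul V).mul_const W).norm
  have hi2 : Integrable (fun z => ‖V‖ * ‖W‖ * (‖f z - h z.1‖ + ‖b - a‖)) (μ.prod ν) :=
    ((hf.sub hh').norm.add (integrable_const _)).const_mul _
  calc ∫ z, ‖V * (h z - a) * W‖ ∂μ
      = ∫ z : α × β, ‖V * (h z.1 - a) * W‖ ∂(μ.prod ν) := by
        rw [integral_fun_fst (fun z => ‖V * (h z - a) * W‖)]; simp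
    _ ≤ ∫ z, (‖V * (f z - b) * W‖ + ‖V‖ * ‖W‖ * (‖f z - h z.1‖ + ‖b - a‖)) ∂(μ.prod ν) := by
        refine integral_mono_of_nonneg (Eventually.of_forall fun _ => norm_nonneg _) (hi1.add hi2)
          (Eventually.of_forall fun z => ?_)
        have e : V * (h z.1 - a) * W =
            V * (f z - b) * W + V * ((b - a) - (f z - h z.1)) * W := by noncomm_ring
        dsimp only
        rw [e]
        refine (norm_add_le _ _).trans (add_le_add_right ((hmul _).trans ?_) _)
        refine mul_le_mul_of_nonneg_left ?_ (by positivity)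
        rw [add_comm]
        exact norm_sub_le _ _
    _ = ∫ z, ‖V * (f z - b) * W‖ ∂(μ.prod ν) + ‖V‖ * ‖W‖ * (ε + ‖b - a‖) := by
        have hi3 : Integrable (fun z => ‖f z - h z.1‖) (μ.prod ν) := (hf.sub hh').norm
        rw [integral_add hi1 hi2, integral_const_mul, integral_add hi3 (integrable_const _)]
        simp [ε]
    _ ≤ _ := by
        have : ‖V‖ * ‖W‖ * (ε + ‖b - a‖) ≤ ‖V‖ * ‖W‖ * (ε + ε) := by gcongr
        linarith

end Differentiation

section Operators

variable {H : Type*} [NormedAddCommGroup H] [NormedSpace ℂ H]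

lemma isBounded_range_of_dense_of_tendsto [FiniteDimensional ℂ H] {ι : Type*} {e : ι → H}
    (he : DenseRange e) {T : ℕ → H →L[ℂ] H} {C : ℝ} {M : ℕ → H → ℝ} {L : H → ℝ}
    (hup : ∀ k v, ‖T k v‖ ≤ C * M k v)
    (hlim : ∀ j, Tendsto (fun k => M k (e j)) atTop (𝓝 (L (e j)))) :
    Bornology.IsBounded (range T) := by
  have : CompleteSpace H := FiniteDimensional.complete ℂ H
  have hspan : Submodule.span ℂ (range e) = ⊤ := by
    have h1 : IsClosed (Submodule.span ℂ (range e) : Set H) :=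
      Submodule.closed_of_finiteDimensional _
    have h2 : Dense (Submodule.span ℂ (range e) : Set H) := he.mono Submodule.subset_span
    exact SetLike.coe_injective (by rw [← h1.closure_eq, h2.closure_eq]; rfl)
  have hpt : ∀ v, ∃ K, ∀ k, ‖T k v‖ ≤ K := by
    intro v
    have hv : v ∈ Submodule.span ℂ (range e) := hspan ▸ Submodule.mem_top
    induction hv using Submodule.span_induction with
    | mem v hv =>
      obtain ⟨j, rfl⟩ := hv
      obtain ⟨K, hK⟩ := ((hlim j).const_mul C).bddAbove_range
      exact ⟨K, fun k => (hup k _).trans (hK ⟨k, rfl⟩)⟩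
    | zero => exact ⟨0, fun k => by simp⟩
    | add x y _ _ hx hy =>
      obtain ⟨K, hK⟩ := hx
      obtain ⟨K', hK'⟩ := hy
      exact ⟨K + K', fun k => by
        rw [map_add]; exact (norm_add_le _ _).trans (add_le_add (hK k) (hK' k))⟩
    | smul c x _ hx =>
      obtain ⟨K, hK⟩ := hx
      exact ⟨‖c‖ * K, fun k => by
        rw [map_smul, norm_smul]; exact mul_le_mul_of_nonneg_left (hK k) (norm_nonneg _)⟩
  obtain ⟨K, hK⟩ := banach_steinhaus hpt
  exact isBounded_iff_forall_norm_le.2 ⟨K, by rintro _ ⟨k, rfl⟩; exact hK k⟩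

lemma norm_comparable_of_tendsto {ι : Type*} {e : ι → H} (he : DenseRange e)
    {T : ℕ → H →L[ℂ] H} {C : ℝ} (hC : 0 ≤ C) {M : ℕ → H → ℝ} {L : H → ℝ}
    (hlow : ∀ k v, M k v ≤ ‖T k v‖) (hup : ∀ k v, ‖T k v‖ ≤ C * M k v)
    (hlim : ∀ j, Tendsto (fun k => M k (e j)) atTop (𝓝 (L (e j)))) {X : H →L[ℂ] H}
    (hXlow : ∀ v, L v ≤ ‖X v‖) (hXup : ∀ v, ‖X v‖ ≤ C * L v)
    {φ : ℕ → ℕ} (hφ : StrictMono φ) {T₀ : H →L[ℂ] H} (hT : Tendsto (T ∘ φ) atTop (𝓝 T₀)) (v : H) :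
    ‖X v‖ ≤ C * ‖T₀ v‖ ∧ ‖T₀ v‖ ≤ C * ‖X v‖ := by
  have hTe : ∀ w, Tendsto (fun k => ‖T (φ k) w‖) atTop (𝓝 ‖T₀ w‖) := fun w =>
    (((ContinuousLinearMap.apply ℂ H w).continuous.tendsto T₀).comp hT).norm
  refine he.induction_on (p := fun v => ‖X v‖ ≤ C * ‖T₀ v‖ ∧ ‖T₀ v‖ ≤ C * ‖X v‖) v ?_ fun j => ?_
  · have hX : Continuous fun v => ‖X v‖ := X.continuous.norm
    have hT₀ : Continuous fun v => ‖T₀ v‖ := T₀.continuous.norm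
    exact (isClosed_le hX (hT₀.const_mul C)).inter (isClosed_le hT₀ (hX.const_mul C))
  · have hM := (hlim j).comp hφ.tendsto_atTop
    constructor
    · exact (hXup _).trans (mul_le_mul_of_nonneg_left
        (le_of_tendsto_of_tendsto' hM (hTe (e j)) fun k => hlow _ _) hC)
    · exact (le_of_tendsto_of_tendsto' (hTe (e j)) (hM.const_mul C) fun k => hup _ _).trans
        (mul_le_mul_of_nonneg_left (hXlow _) hC)

lemma isUnit_of_norm_le [FiniteDimensional ℂ H] {X X' T : H →L[ℂ] H} (hX : X' * X = 1) {C : ℝ}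
    (h : ∀ v, ‖X v‖ ≤ C * ‖T v‖) : IsUnit T := by
  have : CompleteSpace H := FiniteDimensional.complete ℂ H
  have hinj : Function.Injective T := by
    refine (injective_iff_map_eq_zero T).2 fun v hv => ?_
    have h0 : X v = 0 := by simpa [hv] using h v
    have : (X' * X) v = 0 := by simp [h0]
    simpa [hX] using this
  refine ContinuousLinearMap.isUnit_iff_bijective.2 ⟨hinj, ?_⟩
  exact (LinearMap.injective_iff_surjective (f := (T : H →ₗ[ℂ] H))).1 hinj

lemma norm_mul_mul_le_of_comparable {V V₀ U U₀ W W₀ : H →L[ℂ] H} {C : ℝ} (hC : 0 ≤ C)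
    (hV : ∀ v, ‖V v‖ ≤ C * ‖V₀ v‖) (hU : ∀ v, ‖U₀ v‖ ≤ C * ‖U v‖) (hUW : U * W = 1)
    (hW₀ : W₀ * U₀ = 1) (Z : H →L[ℂ] H) : ‖V * Z * W‖ ≤ C ^ 2 * ‖V₀ * Z * W₀‖ := by
  have h1 : ‖V * Z * W‖ ≤ C * ‖V₀ * Z * W‖ := by
    refine ContinuousLinearMap.opNorm_le_bound _ (by positivity) fun v => ?_
    calc ‖V (Z (W v))‖ ≤ C * ‖V₀ (Z (W v))‖ := hV _
      _ = C * ‖(V₀ * Z * W) v‖ := rfl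
      _ ≤ C * (‖V₀ * Z * W‖ * ‖v‖) :=
        mul_le_mul_of_nonneg_left (ContinuousLinearMap.le_opNorm _ _) hC
      _ = _ := by ring
  have h2 : ‖U₀ * W‖ ≤ C := by
    refine ContinuousLinearMap.opNorm_le_bound _ hC fun v => ?_
    refine (hU (W v)).trans (le_of_eq ?_)
    rw [show U (W v) = (U * W) v from rfl, hUW]
    rfl
  have h3 : V₀ * Z * W = V₀ * Z * W₀ * (U₀ * W) := by
    rw [mul_assoc (V₀ * Z) W₀, ← mul_assoc W₀, hW₀, one_mul]
  calc ‖V * Z * W‖ ≤ C * (‖V₀ * Z * W₀‖ * ‖U₀ * W‖) := by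
        refine h1.trans (mul_le_mul_of_nonneg_left ?_ hC)
        rw [h3]
        exact norm_mul_le _ _
    _ ≤ C * (‖V₀ * Z * W₀‖ * C) := by gcongr
    _ = _ := by ring

/-- Passage to the limit in the oscillations along rectangles shrinking to a slice. -/
lemma integral_norm_slice_oscillation_le [FiniteDimensional ℂ H] {α β ι : Type*}
    [MeasurableSpace α] [MeasurableSpace β] {μ : Measure α} [IsProbabilityMeasure μ]
    {ν : ℕ → Measure β} [∀ k, IsProbabilityMeasure (ν k)] {f : α × β → H →L[ℂ] H}
    {h : α → H →L[ℂ] H} (hf : ∀ k, Integrable f (μ.prod (ν k))) (hh : Integrable h μ)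
    (hε : Tendsto (fun k => ∫ z, ‖f z - h z.1‖ ∂(μ.prod (ν k))) atTop (𝓝 0))
    {e : ι → H} (he : DenseRange e) {C : ℝ} (hC : 0 ≤ C)
    {V U W : ℕ → H →L[ℂ] H} {MV MU : ℕ → H → ℝ} {LV LU : H → ℝ}
    (hVlow : ∀ k v, MV k v ≤ ‖V k v‖) (hVup : ∀ k v, ‖V k v‖ ≤ C * MV k v)
    (hVlim : ∀ j, Tendsto (fun k => MV k (e j)) atTop (𝓝 (LV (e j))))
    (hUlow : ∀ k v, MU k v ≤ ‖U k v‖) (hUup : ∀ k v, ‖U k v‖ ≤ C * MU k v)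
    (hUlim : ∀ j, Tendsto (fun k => MU k (e j)) atTop (𝓝 (LU (e j))))
    (hUW : ∀ k, U k * W k = 1) (hWU : ∀ k, W k * U k = 1)
    {X Y Y' : H →L[ℂ] H} (hXlow : ∀ v, LV v ≤ ‖X v‖) (hXup : ∀ v, ‖X v‖ ≤ C * LV v)
    (hYlow : ∀ v, LU v ≤ ‖Y v‖) (hYup : ∀ v, ‖Y v‖ ≤ C * LU v)
    (hYY' : Y * Y' = 1) (hY'Y : Y' * Y = 1) {N : ℝ}
    (hN : ∀ k, ∫ z, ‖V k * (f z - ∫ t, f t ∂(μ.prod (ν k))) * W k‖ ∂(μ.prod (ν k)) ≤ N) :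
    ∫ z, ‖X * (h z - ∫ t, h t ∂μ) * Y'‖ ∂μ ≤ C ^ 2 * N := by
  have : CompleteSpace H := FiniteDimensional.complete ℂ H
  have : ProperSpace ((H →L[ℂ] H) × (H →L[ℂ] H)) := FiniteDimensional.proper ℂ _
  have hbdd : Bornology.IsBounded (range V ×ˢ range U) :=
    (isBounded_range_of_dense_of_tendsto he hVup hVlim).prod
      (isBounded_range_of_dense_of_tendsto he hUup hUlim)
  obtain ⟨⟨V₀, U₀⟩, -, φ, hφ, hlim⟩ := tendsto_subseq_of_bounded hbdd
    (x := fun k => (V k, U k)) fun k => ⟨⟨k, rfl⟩, ⟨k, rfl⟩⟩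
  have hV₀ : Tendsto (V ∘ φ) atTop (𝓝 V₀) := (continuous_fst.tendsto _).comp hlim
  have hU₀ : Tendsto (U ∘ φ) atTop (𝓝 U₀) := (continuous_snd.tendsto _).comp hlim
  have hcV := norm_comparable_of_tendsto he hC hVlow hVup hVlim hXlow hXup hφ hV₀
  have hcU := norm_comparable_of_tendsto he hC hUlow hUup hUlim hYlow hYup hφ hU₀
  obtain ⟨u, hu⟩ := isUnit_of_norm_le hY'Y fun v => (hcU v).1
  have hWinv : ∀ k, W k = Ring.inverse (U k) := fun k =>
    (Ring.inverse_unit (⟨U k, W k, hUW k, hWU k⟩ : (H →L[ℂ] H)ˣ)).symm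
  have hW₀ : Tendsto (W ∘ φ) atTop (𝓝 (↑u⁻¹ : H →L[ℂ] H)) := by
    have := (NormedRing.inverse_continuousAt u).tendsto
    rw [hu, ← hu, Ring.inverse_unit, hu] at this
    refine (this.comp hU₀).congr fun k => (hWinv _).symm
  set a := ∫ t, h t ∂μ
  have hha : Integrable (fun z => h z - a) μ := hh.sub (integrable_const a)
  have hJ : Tendsto (fun k => ∫ z, ‖V (φ k) * (h z - a) * W (φ k)‖ ∂μ) atTop
      (𝓝 (∫ z, ‖V₀ * (h z - a) * (↑u⁻¹ : H →L[ℂ] H)‖ ∂μ)) := by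
    obtain ⟨K, hK⟩ := isBounded_iff_forall_norm_le.1 (Metric.isBounded_range_of_tendsto _ hV₀)
    obtain ⟨K', hK'⟩ := isBounded_iff_forall_norm_le.1 (Metric.isBounded_range_of_tendsto _ hW₀)
    refine tendsto_integral_of_dominated_convergence (fun z => K * ‖h z - a‖ * K') (fun k => ?_)
      ((hha.norm.const_mul K).mul_const K') (fun k => Eventually.of_forall fun z => ?_)
      (Eventually.of_forall fun z => ?_)
    · exact ((hha.const_mul (V (φ k))).mul_const (W (φ k))).norm.aestronglyMeasurable
    · rw [norm_norm]
      have hKk := hK _ ⟨k, rfl⟩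
      have hKk' := hK' _ ⟨k, rfl⟩
      have hK0 : 0 ≤ K := (norm_nonneg _).trans hKk
      calc ‖V (φ k) * (h z - a) * W (φ k)‖ ≤ ‖V (φ k)‖ * ‖h z - a‖ * ‖W (φ k)‖ :=
            (norm_mul_le _ _).trans (mul_le_mul_of_nonneg_right (norm_mul_le _ _) (norm_nonneg _))
        _ ≤ K * ‖h z - a‖ * K' := by
            gcongr
            · exact hKk
            · exact hKk'
    · exact ((hV₀.mul_const (h z - a)).mul hW₀).norm
  have hJN : ∫ z, ‖V₀ * (h z - a) * (↑u⁻¹ : H →L[ℂ] H)‖ ∂μ ≤ N := by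
    have hR : Tendsto (fun k => N + 2 * ‖V (φ k)‖ * ‖W (φ k)‖ *
        ∫ z, ‖f z - h z.1‖ ∂(μ.prod (ν (φ k)))) atTop
        (𝓝 (N + 2 * ‖V₀‖ * ‖(↑u⁻¹ : H →L[ℂ] H)‖ * 0)) :=
      tendsto_const_nhds.add (((tendsto_const_nhds.mul hV₀.norm).mul hW₀.norm).mul
        (hε.comp hφ.tendsto_atTop))
    rw [mul_zero, add_zero] at hR
    refine le_of_tendsto_of_tendsto' hJ hR fun k => ?_
    exact (integral_norm_mul_sub_average_mul_le (hf (φ k)) hh _ _).trans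
      (add_le_add_left (hN (φ k)) _)
  calc ∫ z, ‖X * (h z - a) * Y'‖ ∂μ
      ≤ ∫ z, C ^ 2 * ‖V₀ * (h z - a) * (↑u⁻¹ : H →L[ℂ] H)‖ ∂μ := by
        refine integral_mono_of_nonneg (Eventually.of_forall fun _ => norm_nonneg _)
          (((hha.const_mul V₀).mul_const _).norm.const_mul _) (Eventually.of_forall fun z => ?_)
        exact norm_mul_mul_le_of_comparable hC (fun v => (hcV v).1) (fun v => (hcU v).2) hYY'
          (by rw [← hu]; exact u.inv_mul) _
    _ ≤ C ^ 2 * N := by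
        rw [integral_const_mul]
        exact mul_le_mul_of_nonneg_left hJN (by positivity)

end Operators

section Slices

variable {X : Type*} {d : ℕ}

/-- The matrix of a linear operator on `ℂ^d` with its Euclidean norm, viewed as an operator. -/
abbrev toOp (M : Matrix (Fin d) (Fin d) ℂ) :
    EuclideanSpace ℂ (Fin d) →L[ℂ] EuclideanSpace ℂ (Fin d) :=
  Matrix.toEuclideanCLM (𝕜 := ℂ) (n := Fin d) M

/-- The density `|W(x)^{1/p} v|^p`. -/
def wDensity (p : ℝ) (W : X → Matrix (Fin d) (Fin d) ℂ) (v : EuclideanSpace ℂ (Fin d)) (x : X) :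
    ℝ :=
  vNorm d ((matRpow (W x) (1 / p)).mulVec (WithLp.ofLp v)) ^ p

lemma wDensity_zero {p : ℝ} (hp : 0 < p) (W : X → Matrix (Fin d) (Fin d) ℂ) (x : X) :
    wDensity p W 0 x = 0 := by
  simp [wDensity, vNorm, Real.zero_rpow hp.ne']

variable [MeasureSpace X]

lemma IsReducing.le_norm {p : ℝ} {W : X → Matrix (Fin d) (Fin d) ℂ} {E : Set X}
    {M : Matrix (Fin d) (Fin d) ℂ} (h : IsReducing p W E M) (v : EuclideanSpace ℂ (Fin d)) :
    (∫ x, wDensity p W v x ∂(ProbabilityTheory.cond volume E)) ^ (1 / p) ≤ ‖toOp M v‖ := by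
  have := (h.2 (WithLp.ofLp v)).1
  rwa [setAverage_eq'] at this

lemma IsReducing.norm_le {p : ℝ} {W : X → Matrix (Fin d) (Fin d) ℂ} {E : Set X}
    {M : Matrix (Fin d) (Fin d) ℂ} (h : IsReducing p W E M) (v : EuclideanSpace ℂ (Fin d)) :
    ‖toOp M v‖ ≤
      √d * (∫ x, wDensity p W v x ∂(ProbabilityTheory.cond volume E)) ^ (1 / p) := by
  have := (h.2 (WithLp.ofLp v)).2
  rwa [setAverage_eq'] at this

lemma toOp_mul_toOp_inv {M : Matrix (Fin d) (Fin d) ℂ} (hM : M.PosDef) :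
    toOp M * toOp M⁻¹ = 1 := by
  rw [← map_mul, Matrix.mul_nonsing_inv _ ((Matrix.isUnit_iff_isUnit_det _).1 hM.isUnit), map_one]

lemma toOp_inv_mul_toOp {M : Matrix (Fin d) (Fin d) ℂ} (hM : M.PosDef) :
    toOp M⁻¹ * toOp M = 1 := by
  rw [← map_mul, Matrix.nonsing_inv_mul _ ((Matrix.isUnit_iff_isUnit_det _).1 hM.isUnit), map_one]

/-- A weight admitting a reducing operator has integrable densities: otherwise the junk value of
the integral would contradict positive definiteness. -/
lemma IsReducing.integrable {p : ℝ} (hp : 0 < p) {W : X → Matrix (Fin d) (Fin d) ℂ} {E : Set X}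
    {M : Matrix (Fin d) (Fin d) ℂ} (h : IsReducing p W E M) (v : EuclideanSpace ℂ (Fin d)) :
    Integrable (wDensity p W v) (ProbabilityTheory.cond volume E) := by
  rcases eq_or_ne v 0 with rfl | hv
  · rw [show wDensity p W 0 = fun _ => (0 : ℝ) from funext (wDensity_zero hp W)]
    exact integrable_zero _ _ _
  · refine Integrable.of_integral_ne_zero fun h0 => hv ?_
    have h1 := h.norm_le v
    rw [h0, Real.zero_rpow (by positivity), mul_zero] at h1
    have h2 : toOp M v = 0 := norm_le_zero_iff.1 h1
    calc v = (toOp M⁻¹ * toOp M) v := by rw [toOp_inv_mul_toOp h.1]; rfl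
      _ = toOp M⁻¹ (toOp M v) := rfl
      _ = 0 := by rw [h2, map_zero]

lemma toOp_matAvg {B : X → Matrix (Fin d) (Fin d) ℂ} {R : Set X}
    (hB : Integrable (fun x => toOp (B x)) (ProbabilityTheory.cond volume R)) :
    toOp (matAvg B R) = ∫ x, toOp (B x) ∂(ProbabilityTheory.cond volume R) := by
  rw [← (Matrix.toEuclideanCLM (𝕜 := ℂ) (n := Fin d)).apply_symm_apply
    (∫ x, toOp (B x) ∂(ProbabilityTheory.cond volume R))]
  unfold toOp
  congr 1
  have hentry : ∀ (M : Matrix (Fin d) (Fin d) ℂ) (i j : Fin d),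
      M i j = (toOp M (EuclideanSpace.single j 1)) i := by
    intro M i j
    change M i j = M.mulVec (Pi.single j 1) i
    simp
  ext i j
  let ev : (EuclideanSpace ℂ (Fin d) →L[ℂ] EuclideanSpace ℂ (Fin d)) →L[ℂ] ℂ :=
    (EuclideanSpace.proj i).comp (ContinuousLinearMap.apply ℂ _ (EuclideanSpace.single j 1))
  refine Eq.trans ?_ (hentry _ i j).symm
  rw [toOp, StarAlgEquiv.apply_symm_apply]
  refine Eq.trans ?_ (ev.integral_comp_comm hB)
  rw [matAvg, Matrix.of_apply, setAverage_eq']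
  exact integral_congr_ae (Eventually.of_forall fun x => hentry (B x) i j)

lemma average_mNorm_eq {B : X → Matrix (Fin d) (Fin d) ℂ} {R : Set X}
    (hB : Integrable (fun x => toOp (B x)) (ProbabilityTheory.cond volume R))
    (M M' : Matrix (Fin d) (Fin d) ℂ) :
    ⨍ x in R, mNorm d (M * (B x - matAvg B R) * M') =
      ∫ x, ‖toOp M * (toOp (B x) - ∫ t, toOp (B t) ∂(ProbabilityTheory.cond volume R)) * toOp M'‖
        ∂(ProbabilityTheory.cond volume R) := by
  rw [setAverage_eq', ← toOp_matAvg hB]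
  refine integral_congr_ae (Eventually.of_forall fun x => ?_)
  simp only [mNorm, toOp, map_mul, map_sub]

lemma LocIntMat.integrableOn [TopologicalSpace X] {B : X → Matrix (Fin d) (Fin d) ℂ}
    (hB : LocIntMat B) {K R : Set X} (hK : IsCompact K) (hR : R ⊆ K) :
    IntegrableOn (fun x => toOp (B x)) R := by
  have hmeas : AEStronglyMeasurable (fun x => toOp (B x)) volume := by
    have : (fun x => toOp (B x)) =
        fun x => ∑ i, ∑ j, B x i j • toOp (Matrix.single i j (1 : ℂ)) := by
      funext x
      conv_lhs => rw [Matrix.matrix_eq_sum_single (B x)]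
      simp only [toOp, map_sum]
      refine Finset.sum_congr rfl fun i _ => Finset.sum_congr rfl fun j _ => ?_
      rw [← map_smul, Matrix.smul_single, smul_eq_mul, mul_one]
    rw [this]
    exact Finset.aestronglyMeasurable_fun_sum _ fun i _ =>
      Finset.aestronglyMeasurable_fun_sum _ fun j _ => (hB.1 i j).smul_const _
  have h := (hB.2.integrableOn_isCompact hK).mono_set hR
  exact (integrable_norm_iff hmeas.restrict).1 h

lemma IsReducing.ae_tendsto_wDensity {n m : ℕ} {G₁ : Set (Set (Fin n → ℝ))}
    {G₂ : Set (Set (Fin m → ℝ))} (hG₁ : IsDyadicGridRn G₁) (hG₂ : IsDyadicGridRn G₂)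
    {P : ℕ → (Fin m → ℝ) → Set (Fin m → ℝ)} (hPG : ∀ k x, P k x ∈ G₂)
    (hdiff : ∀ F : (Fin m → ℝ) → ℝ, (∀ Q ∈ G₂, IntegrableOn F Q) →
      ∀ᵐ x, Tendsto (fun k => ∫ y, F y ∂(ProbabilityTheory.cond volume (P k x))) atTop (𝓝 (F x)))
    {p : ℝ} (hp : 0 < p) {W : (Fin n → ℝ) × (Fin m → ℝ) → Matrix (Fin d) (Fin d) ℂ}
    {RW : Set ((Fin n → ℝ) × (Fin m → ℝ)) → Matrix (Fin d) (Fin d) ℂ}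
    (hRW : ∀ Q ∈ G₁, ∀ S ∈ G₂, IsReducing p W (Q ×ˢ S) (RW (Q ×ˢ S))) {Q : Set (Fin n → ℝ)}
    (hQ : Q ∈ G₁) (v : EuclideanSpace ℂ (Fin d)) :
    ∀ᵐ x₂, Tendsto (fun k => (∫ z, wDensity p W v z
        ∂(ProbabilityTheory.cond volume (Q ×ˢ P k x₂))) ^ (1 / p)) atTop
      (𝓝 ((∫ x₁, wDensity p (fun x₁ => W (x₁, x₂)) v x₁
        ∂(ProbabilityTheory.cond volume Q)) ^ (1 / p))) := by
  have hi : ∀ S ∈ G₂, Integrable (wDensity p W v)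
      ((ProbabilityTheory.cond volume Q).prod (ProbabilityTheory.cond volume S)) := by
    intro S hS
    rw [← cond_prod_cond (hG₁.volume_ne_top hQ) (hG₂.volume_ne_top hS)]
    exact (hRW Q hQ S hS).integrable hp v
  have hF := hdiff (fun y => ∫ x, wDensity p W v (x, y) ∂(ProbabilityTheory.cond volume Q))
    fun S hS => by
      rw [← integrable_cond_iff (hG₂.volume_ne_zero hS) (hG₂.volume_ne_top hS)]
      exact (hi S hS).integral_prod_right
  filter_upwards [hF] with x₂ hx₂
  refine Tendsto.rpow_const (Tendsto.congr (fun k => ?_) hx₂) (Or.inr (by positivity))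
  rw [cond_prod_cond (hG₁.volume_ne_top hQ) (hG₂.volume_ne_top (hPG k x₂))]
  exact (integral_prod_symm _ (hi _ (hPG k x₂))).symm

/-- Almost every slice norm in the first variable is dominated by the biparameter norm. -/
lemma ae_bmoTS_slice_le {n m : ℕ} {G₁ : Set (Set (Fin n → ℝ))} {G₂ : Set (Set (Fin m → ℝ))}
    (hG₁ : IsDyadicGridRn G₁) (hG₂ : IsDyadicGridRn G₂) {p : ℝ} (hp : 0 < p)
    {U V B : (Fin n → ℝ) × (Fin m → ℝ) → Matrix (Fin d) (Fin d) ℂ}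
    {RU RV : Set ((Fin n → ℝ) × (Fin m → ℝ)) → Matrix (Fin d) (Fin d) ℂ}
    {RU₁ RV₁ : (Fin m → ℝ) → Set (Fin n → ℝ) → Matrix (Fin d) (Fin d) ℂ}
    (hB : ∀ Q ∈ G₁, ∀ S ∈ G₂, IntegrableOn (fun x => toOp (B x)) (Q ×ˢ S))
    (hRU : ∀ Q ∈ G₁, ∀ S ∈ G₂, IsReducing p U (Q ×ˢ S) (RU (Q ×ˢ S)))
    (hRV : ∀ Q ∈ G₁, ∀ S ∈ G₂, IsReducing p V (Q ×ˢ S) (RV (Q ×ˢ S)))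
    (hRU₁ : ∀ᵐ x₂, ∀ Q ∈ G₁, IsReducing p (fun x₁ => U (x₁, x₂)) Q (RU₁ x₂ Q))
    (hRV₁ : ∀ᵐ x₂, ∀ Q ∈ G₁, IsReducing p (fun x₁ => V (x₁, x₂)) Q (RV₁ x₂ Q)) :
    ∀ᵐ x₂, bmoTS (fun x₁ => B (x₁, x₂)) (RU₁ x₂) (RV₁ x₂) G₁ ≤
      ENNReal.ofReal (d + 1) * bmoTS B RU RV (prodFam G₁ G₂) := by
  have hd : (0 : ℝ) < d + 1 := by positivity
  rcases eq_or_ne (bmoTS B RU RV (prodFam G₁ G₂)) ∞ with htop | htop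
  · rw [htop, ENNReal.mul_top (by simpa using hd)]
    exact Eventually.of_forall fun _ => le_top
  set N : ℝ := (bmoTS B RU RV (prodFam G₁ G₂)).toReal
  have hN0 : 0 ≤ N := ENNReal.toReal_nonneg
  have hN : ∀ Q ∈ G₁, ∀ S ∈ G₂, ⨍ x in Q ×ˢ S,
      mNorm d (RV (Q ×ˢ S) * (B x - matAvg B (Q ×ˢ S)) * (RU (Q ×ˢ S))⁻¹) ≤ N := by
    intro Q hQ S hS
    refine (ENNReal.ofReal_le_iff_le_toReal htop).1 ?_
    exact le_iSup₂ (f := fun R (_ : R ∈ prodFam G₁ G₂) =>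
      ENNReal.ofReal (⨍ x in R, mNorm d (RV R * (B x - matAvg B R) * (RU R)⁻¹)))
      (Q ×ˢ S) ⟨Q, hQ, S, hS, rfl⟩
  obtain ⟨P, hPG, hPm, hdiff⟩ := hG₂.exists_cubes
  have hprod : ∀ Q ∈ G₁, ∀ S ∈ G₂, ProbabilityTheory.cond volume (Q ×ˢ S) =
      (ProbabilityTheory.cond volume Q).prod (ProbabilityTheory.cond volume S) :=
    fun Q hQ S hS => cond_prod_cond (hG₁.volume_ne_top hQ) (hG₂.volume_ne_top hS)
  have hBi : ∀ Q ∈ G₁, ∀ S ∈ G₂,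
      Integrable (fun x => toOp (B x)) (ProbabilityTheory.cond volume (Q ×ˢ S)) :=
    fun Q hQ S hS => by
      refine (integrable_cond_iff ?_ ?_).2 (hB Q hQ S hS) <;>
        rw [Measure.volume_eq_prod, Measure.prod_prod]
      · exact mul_ne_zero (hG₁.volume_ne_zero hQ) (hG₂.volume_ne_zero hS)
      · exact ENNReal.mul_ne_top (hG₁.volume_ne_top hQ) (hG₂.volume_ne_top hS)
  have : ProperSpace (EuclideanSpace ℂ (Fin d) →L[ℂ] EuclideanSpace ℂ (Fin d)) :=
    FiniteDimensional.proper ℂ _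
  let e := TopologicalSpace.denseSeq (EuclideanSpace ℂ (Fin d))
  have hgood : ∀ Q ∈ G₁, ∀ᵐ x₂,
      ⨍ x₁ in Q, mNorm d (RV₁ x₂ Q * (B (x₁, x₂) - matAvg (fun x₁ => B (x₁, x₂)) Q) *
        (RU₁ x₂ Q)⁻¹) ≤ (d + 1) * N := by
    intro Q hQ
    have := hG₁.isProbabilityMeasure_cond hQ
    have hBQ : ∀ S ∈ G₂, Integrable (fun x => toOp (B x))
        ((ProbabilityTheory.cond volume Q).prod (volume.restrict S)) :=
      fun S hS => integrable_cond_prod_restrict (hG₁.volume_ne_zero hQ) (hB Q hQ S hS)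
    filter_upwards [hRU₁, hRV₁,
      ae_all_iff.2 fun j =>
        IsReducing.ae_tendsto_wDensity hG₁ hG₂ hPG hdiff hp hRU hQ (e j),
      ae_all_iff.2 fun j =>
        IsReducing.ae_tendsto_wDensity hG₁ hG₂ hPG hdiff hp hRV hQ (e j),
      ae_tendsto_integral_norm_sub_slice hG₂.countable (fun _ => hG₂.measurableSet)
        (fun _ => hG₂.volume_ne_zero) (fun _ => hG₂.volume_ne_top) hPG hPm hdiff hBQ]
      with x₂ hU₁ hV₁ hUlim hVlim ⟨hh, hε⟩
    have : ∀ k, IsProbabilityMeasure (ProbabilityTheory.cond (volume : Measure (Fin m → ℝ))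
      (P k x₂)) := fun k => hG₂.isProbabilityMeasure_cond (hPG k x₂)
    rw [average_mNorm_eq hh]
    have key := integral_norm_slice_oscillation_le
      (fun k => hprod Q hQ _ (hPG k x₂) ▸ hBi Q hQ _ (hPG k x₂)) hh hε
      (TopologicalSpace.denseRange_denseSeq (EuclideanSpace ℂ (Fin d))) (Real.sqrt_nonneg d)
      (fun k v => (hRV Q hQ _ (hPG k x₂)).le_norm v) (fun k v => (hRV Q hQ _ (hPG k x₂)).norm_le v)
      hVlim
      (fun k v => (hRU Q hQ _ (hPG k x₂)).le_norm v) (fun k v => (hRU Q hQ _ (hPG k x₂)).norm_le v)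
      hUlim
      (fun k => toOp_mul_toOp_inv (hRU Q hQ _ (hPG k x₂)).1)
      (fun k => toOp_inv_mul_toOp (hRU Q hQ _ (hPG k x₂)).1)
      (fun v => (hV₁ Q hQ).le_norm v) (fun v => (hV₁ Q hQ).norm_le v)
      (fun v => (hU₁ Q hQ).le_norm v) (fun v => (hU₁ Q hQ).norm_le v)
      (toOp_mul_toOp_inv (hU₁ Q hQ).1) (toOp_inv_mul_toOp (hU₁ Q hQ).1) (N := N)
      (fun k => by
        have h := hN Q hQ _ (hPG k x₂)
        rwa [average_mNorm_eq (hBi Q hQ _ (hPG k x₂)), hprod Q hQ _ (hPG k x₂)] at h)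
    refine key.trans ?_
    rw [Real.sq_sqrt (Nat.cast_nonneg d)]
    nlinarith
  filter_upwards [(ae_ball_iff hG₁.countable).2 hgood] with x₂ hx₂
  refine iSup₂_le fun Q hQ => ?_
  rw [← ENNReal.ofReal_toReal htop, ← ENNReal.ofReal_mul hd.le]
  exact ENNReal.ofReal_le_ofReal (hx₂ Q hQ)

end Slices

section Swap

variable {n m d : ℕ}

lemma setAverage_prod_swap {F : Type*} [NormedAddCommGroup F] [NormedSpace ℝ F]
    (g : (Fin n → ℝ) × (Fin m → ℝ) → F) (Q : Set (Fin n → ℝ)) (S : Set (Fin m → ℝ)) :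
    ⨍ x in S ×ˢ Q, g x.swap = ⨍ x in Q ×ˢ S, g x := by
  have hmp : MeasurePreserving (Prod.swap : (Fin m → ℝ) × (Fin n → ℝ) → _) volume volume :=
    Measure.measurePreserving_swap
  have hme : MeasurableEmbedding (Prod.swap : (Fin m → ℝ) × (Fin n → ℝ) → _) :=
    MeasurableEquiv.prodComm.measurableEmbedding
  have hv : volume.real (S ×ˢ Q) = volume.real (Q ×ˢ S) := by
    simp only [measureReal_def, Measure.volume_eq_prod, Measure.prod_prod, mul_comm]
  rw [setAverage_eq, setAverage_eq, hv, ← hmp.setIntegral_preimage_emb hme, preimage_swap_prod]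

lemma IsReducing.swap {p : ℝ} {W : (Fin n → ℝ) × (Fin m → ℝ) → Matrix (Fin d) (Fin d) ℂ}
    {Q : Set (Fin n → ℝ)} {S : Set (Fin m → ℝ)} {M : Matrix (Fin d) (Fin d) ℂ}
    (h : IsReducing p W (Q ×ˢ S) M) : IsReducing p (fun x => W x.swap) (S ×ˢ Q) M := by
  refine ⟨h.1, fun v => ?_⟩
  rw [setAverage_prod_swap (fun x => vNorm d ((matRpow (W x) (1 / p)).mulVec v) ^ p)]
  exact h.2 v

lemma bmoTS_swap (B : (Fin n → ℝ) × (Fin m → ℝ) → Matrix (Fin d) (Fin d) ℂ)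
    (RU RV : Set ((Fin n → ℝ) × (Fin m → ℝ)) → Matrix (Fin d) (Fin d) ℂ)
    (G₁ : Set (Set (Fin n → ℝ))) (G₂ : Set (Set (Fin m → ℝ))) :
    bmoTS (fun x => B x.swap) (fun R => RU (Prod.swap ⁻¹' R)) (fun R => RV (Prod.swap ⁻¹' R))
      (prodFam G₂ G₁) ≤ bmoTS B RU RV (prodFam G₁ G₂) := by
  refine iSup₂_le fun R hR => ?_
  obtain ⟨S, hS, Q, hQ, rfl⟩ := hR
  have havg : matAvg (fun x => B x.swap) (S ×ˢ Q) = matAvg B (Q ×ˢ S) := by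
    ext i j
    exact setAverage_prod_swap (fun x => B x i j) Q S
  beta_reduce
  rw [havg, preimage_swap_prod, setAverage_prod_swap (fun x => mNorm d (RV (Q ×ˢ S) *
    (B x - matAvg B (Q ×ˢ S)) * (RU (Q ×ˢ S))⁻¹))]
  exact le_iSup₂ (f := fun R (_ : R ∈ prodFam G₁ G₂) =>
    ENNReal.ofReal (⨍ x in R, mNorm d (RV R * (B x - matAvg B R) * (RU R)⁻¹)))
    (Q ×ˢ S) ⟨Q, hQ, S, hS, rfl⟩

end Swap

end Auxiliary

/-- For a product dyadic grid `𝒟 = 𝒟¹ × 𝒟²`, `𝒟`-dyadic matrix `A_p`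
weights `U, V` and `B ∈ L¹_loc`, the dyadic norm `‖B‖_{bmõ_𝒟(U,V,p)}` dominates (up to a
constant `c > 0` depending only on `p` and `d`) the maximum of the essential suprema of the
slice norms `‖B_{x₂}‖_{B̃MO_{𝒟¹}(U_{x₂},V_{x₂},p)}` and `‖B_{x₁}‖_{B̃MO_{𝒟²}(U_{x₁},V_{x₁},p)}`. -/
theorem dyadic_bmo_tilde_ge_slice_bmo_tilde (d : ℕ) (p : ℝ) (hp : 1 < p) :
    ∃ c : ℝ, 0 < c ∧
      ∀ (n m : ℕ) (G₁ : Set (Set (Fin n → ℝ))) (G₂ : Set (Set (Fin m → ℝ)))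
        (G : Set (Set ((Fin n → ℝ) × (Fin m → ℝ)))),
        IsProductDyadicGrid G₁ G₂ G →
        ∀ (CU CV : ℝ) (U V B : ((Fin n → ℝ) × (Fin m → ℝ)) → Matrix (Fin d) (Fin d) ℂ)
          (RU RV : Set ((Fin n → ℝ) × (Fin m → ℝ)) → Matrix (Fin d) (Fin d) ℂ)
          (RU₁ RV₁ : (Fin m → ℝ) → Set (Fin n → ℝ) → Matrix (Fin d) (Fin d) ℂ)
          (RU₂ RV₂ : (Fin n → ℝ) → Set (Fin m → ℝ) → Matrix (Fin d) (Fin d) ℂ),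
          IsApWeight p CU U G →
          IsApWeight p CV V G →
          LocIntMat B →
          (∀ R ∈ G, IsReducing p U R (RU R)) →
          (∀ R ∈ G, IsReducing p V R (RV R)) →
          (∀ᵐ x₂ : Fin m → ℝ, ∀ Q ∈ G₁, IsReducing p (fun x₁ => U (x₁, x₂)) Q (RU₁ x₂ Q)) →
          (∀ᵐ x₂ : Fin m → ℝ, ∀ Q ∈ G₁, IsReducing p (fun x₁ => V (x₁, x₂)) Q (RV₁ x₂ Q)) →
          (∀ᵐ x₁ : Fin n → ℝ, ∀ Q ∈ G₂, IsReducing p (fun x₂ => U (x₁, x₂)) Q (RU₂ x₁ Q)) →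
          (∀ᵐ x₁ : Fin n → ℝ, ∀ Q ∈ G₂, IsReducing p (fun x₂ => V (x₁, x₂)) Q (RV₂ x₁ Q)) →
          ENNReal.ofReal c *
            max
              (essSup (fun x₂ : Fin m → ℝ =>
                bmoTS (fun x₁ => B (x₁, x₂)) (RU₁ x₂) (RV₁ x₂) G₁) volume)
              (essSup (fun x₁ : Fin n → ℝ =>
                bmoTS (fun x₂ => B (x₁, x₂)) (RU₂ x₁) (RV₂ x₁) G₂) volume)
            ≤ bmoTS B RU RV G := by
  have hp0 : 0 < p := by linarith
  have hd : (0 : ℝ) < d + 1 := by positivity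
  refine ⟨(d + 1)⁻¹, by positivity, ?_⟩
  rintro n m G₁ G₂ _ ⟨hG₁, hG₂, rfl⟩ CU CV U V B RU RV RU₁ RV₁ RU₂ RV₂ - - hB hRU hRV
    hRU₁ hRV₁ hRU₂ hRV₂
  have hBi : ∀ Q ∈ G₁, ∀ S ∈ G₂, IntegrableOn (fun x => toOp (B x)) (Q ×ˢ S) := by
    intro Q hQ S hS
    obtain ⟨K₁, hK₁, hQK⟩ := hG₁.exists_isCompact hQ
    obtain ⟨K₂, hK₂, hSK⟩ := hG₂.exists_isCompact hS
    exact hB.integrableOn (hK₁.prod hK₂) (Set.prod_mono hQK hSK)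
  have hU : ∀ Q ∈ G₁, ∀ S ∈ G₂, IsReducing p U (Q ×ˢ S) (RU (Q ×ˢ S)) :=
    fun Q hQ S hS => hRU _ ⟨Q, hQ, S, hS, rfl⟩
  have hV : ∀ Q ∈ G₁, ∀ S ∈ G₂, IsReducing p V (Q ×ˢ S) (RV (Q ×ˢ S)) :=
    fun Q hQ S hS => hRV _ ⟨Q, hQ, S, hS, rfl⟩
  have h₁ := ae_bmoTS_slice_le hG₁ hG₂ hp0 hBi hU hV hRU₁ hRV₁
  have h₂ := ae_bmoTS_slice_le (B := fun x => B x.swap) (U := fun x => U x.swap)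
    (V := fun x => V x.swap) (RU := fun R => RU (Prod.swap ⁻¹' R))
    (RV := fun R => RV (Prod.swap ⁻¹' R)) hG₂ hG₁ hp0
    (fun S hS Q hQ => by
      rw [← Set.preimage_swap_prod]
      exact (Measure.measurePreserving_swap.integrableOn_comp_preimage
        MeasurableEquiv.prodComm.measurableEmbedding).2 (hBi Q hQ S hS))
    (fun S hS Q hQ => by
      rw [Set.preimage_swap_prod]
      exact (hU Q hQ S hS).swap)
    (fun S hS Q hQ => by
      rw [Set.preimage_swap_prod]
      exact (hV Q hQ S hS).swap) hRU₂ hRV₂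
  calc _ ≤ ENNReal.ofReal (d + 1)⁻¹ *
        (ENNReal.ofReal (d + 1) * bmoTS B RU RV (prodFam G₁ G₂)) :=
        mul_le_mul_right (max_le (essSup_le_of_ae_le _ h₁) (essSup_le_of_ae_le _ (h₂.mono
          fun _ h => h.trans (mul_le_mul_right (bmoTS_swap B RU RV G₁ G₂) _)))) _
    _ = bmoTS B RU RV (prodFam G₁ G₂) := by
        rw [← mul_assoc, ← ENNReal.ofReal_mul (by positivity), inv_mul_cancel₀ hd.ne',
          ENNReal.ofReal_one, one_mul]

end TwoWeightBMO
end
end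

section
/- Let φ∈C_c^∞(ℝ^{n+m}). Then the three functions (x,y)↦|x|·φ(x,y), (x,y)↦|y|·φ(x,y) and (x,y)↦|x|·|y|·φ(x,y), for (x,y)∈ℝ^n×ℝ^m, all belong to the Wiener algebra W_0(ℝ^{n+m}); that is, each of them is the Fourier transform of some function in L¹(ℝ^{n+m}). -/
open MeasureTheory Filter
open scoped ENNReal ComplexOrder

noncomputable section

namespace TwoWeightBMO

open ProbabilityTheory

/-- The Euclidean pairing on `ℝ^n × ℝ^m`. -/
def phase {n m : ℕ} (t x : (Fin n → ℝ) × (Fin m → ℝ)) : ℝ :=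
  (∑ i, t.1 i * x.1 i) + ∑ i, t.2 i * x.2 i

/-- Membership in the Wiener algebra `W₀(ℝ^{n+m})`. -/
def IsWiener {n m : ℕ} (f : ((Fin n → ℝ) × (Fin m → ℝ)) → ℂ) : Prop :=
  ∃ ρ : ((Fin n → ℝ) × (Fin m → ℝ)) → ℂ, Integrable ρ ∧ ∀ t, f t = ft ρ t

lemma ft_eq {n m : ℕ} (ρ : ((Fin n → ℝ) × (Fin m → ℝ)) → ℂ) (t : (Fin n → ℝ) × (Fin m → ℝ)) :
    ft ρ t = ∫ x, ρ x * Complex.exp (-Complex.I * (phase t x : ℂ)) := rfl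

lemma phase_add {n m : ℕ} (t x y : (Fin n → ℝ) × (Fin m → ℝ)) :
    phase t (x + y) = phase t x + phase t y := by
  simp only [phase, Prod.fst_add, Prod.snd_add, Pi.add_apply, mul_add, Finset.sum_add_distrib]
  ring

lemma continuous_phase {n m : ℕ} (t : (Fin n → ℝ) × (Fin m → ℝ)) : Continuous (phase t) := by
  unfold phase
  fun_prop

lemma norm_exp_neg_I_mul (a : ℝ) : ‖Complex.exp (-Complex.I * (a : ℂ))‖ = 1 := by
  rw [show -Complex.I * (a : ℂ) = ((-a : ℝ) : ℂ) * Complex.I by push_cast; ring]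
  exact Complex.norm_exp_ofReal_mul_I _

lemma integrable_mul_exp {n m : ℕ} {X : Type*} [MeasurableSpace X] {μ : Measure X} {ρ : X → ℂ}
    (hρ : Integrable ρ μ) (t : (Fin n → ℝ) × (Fin m → ℝ))
    {Y : X → (Fin n → ℝ) × (Fin m → ℝ)} (hY : Measurable Y) :
    Integrable (fun x => ρ x * Complex.exp (-Complex.I * (phase t (Y x) : ℂ))) μ := by
  refine hρ.mul_bdd (c := 1) ?_ (ae_of_all _ fun x => (norm_exp_neg_I_mul _).le)
  have := (continuous_phase t).measurable.comp hY
  exact (Complex.measurable_exp.comp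
    ((Complex.measurable_ofReal.comp this).const_mul (-Complex.I))).aestronglyMeasurable

lemma IsWiener.add {n m : ℕ} {f g : ((Fin n → ℝ) × (Fin m → ℝ)) → ℂ} (hf : IsWiener f)
    (hg : IsWiener g) : IsWiener (fun t => f t + g t) := by
  obtain ⟨ρ, hρ, hfρ⟩ := hf
  obtain ⟨σ, hσ, hgσ⟩ := hg
  refine ⟨fun x => ρ x + σ x, hρ.add hσ, fun t => ?_⟩
  simp only [hfρ, hgσ, ft_eq, add_mul]
  exact (integral_add (integrable_mul_exp hρ t measurable_id)
    (integrable_mul_exp hσ t measurable_id)).symm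

lemma IsWiener.sub {n m : ℕ} {f g : ((Fin n → ℝ) × (Fin m → ℝ)) → ℂ} (hf : IsWiener f)
    (hg : IsWiener g) : IsWiener (fun t => f t - g t) := by
  obtain ⟨ρ, hρ, hfρ⟩ := hf
  obtain ⟨σ, hσ, hgσ⟩ := hg
  refine ⟨fun x => ρ x - σ x, hρ.sub hσ, fun t => ?_⟩
  simp only [hfρ, hgσ, ft_eq, sub_mul]
  exact (integral_sub (integrable_mul_exp hρ t measurable_id)
    (integrable_mul_exp hσ t measurable_id)).symm

/-- The Wiener algebra is stable under multiplication by Fourier transforms of finite measures. -/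
lemma IsWiener.mul_fourier_measure {n m : ℕ} {f : ((Fin n → ℝ) × (Fin m → ℝ)) → ℂ}
    (hf : IsWiener f) (ν : Measure ((Fin n → ℝ) × (Fin m → ℝ))) [IsFiniteMeasure ν] :
    IsWiener (fun t => f t * ∫ u, Complex.exp (-Complex.I * (phase t u : ℂ)) ∂ν) := by
  obtain ⟨ρ, hρ, hfρ⟩ := hf
  have : (volume : Measure ((Fin n → ℝ) × (Fin m → ℝ))).IsAddHaarMeasure :=
    Measure.prod.instIsAddHaarMeasure (volume : Measure (Fin n → ℝ)) (volume : Measure (Fin m → ℝ))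
  have hint : Integrable (fun p : ((Fin n → ℝ) × (Fin m → ℝ)) × ((Fin n → ℝ) × (Fin m → ℝ)) =>
      ρ (p.1 - p.2)) (volume.prod ν) := by
    simpa using (integrable_const (1 : ℂ)).convolution_integrand (ν := ν)
      (ContinuousLinearMap.mul ℝ ℂ) hρ
  refine ⟨fun x => ∫ u, ρ (x - u) ∂ν, hint.integral_prod_left, fun t => ?_⟩
  simp only [ft_eq, ← integral_mul_const]
  rw [integral_integral_swap (integrable_mul_exp hint t measurable_fst), hfρ,
    ← integral_const_mul]
  refine integral_congr_ae (ae_of_all _ fun u => ?_)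
  simp only [ft_eq]
  rw [← integral_sub_right_eq_self _ u, ← integral_mul_const]
  refine integral_congr_ae (ae_of_all _ fun x => ?_)
  simp only
  rw [mul_assoc, ← Complex.exp_add, ← mul_add, ← Complex.ofReal_add, ← phase_add, sub_add_cancel]

lemma integral_exp_sq_gaussianReal {a : ℝ} (ha : 0 ≤ a) :
    ∫ z, Real.exp (-(a / 2) * z ^ 2) ∂(gaussianReal 0 1) = (√(1 + a))⁻¹ := by
  rw [integral_gaussianReal_eq_integral_smul one_ne_zero]
  have : ∀ z : ℝ, gaussianPDFReal 0 1 z • Real.exp (-(a / 2) * z ^ 2)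
      = (√(2 * Real.pi))⁻¹ * Real.exp (-((1 + a) / 2) * z ^ 2) := by
    intro z
    simp only [gaussianPDFReal, smul_eq_mul, NNReal.coe_one, mul_one, sub_zero, mul_assoc]
    rw [← Real.exp_add]
    ring_nf
  simp_rw [this]
  rw [integral_const_mul, integral_gaussian, ← Real.sqrt_inv, ← Real.sqrt_inv, ← Real.sqrt_mul
    (by positivity)]
  congr 1
  field_simp

/-- The law of `Z / R`, where `Z` is a standard Gaussian and `R` is independent of `Z` and
uniformly distributed on `(0, 1]`. -/
def gaussianQuotient : Measure ℝ :=
  ((gaussianReal 0 1).prod (volume.restrict (Set.Ioc (0 : ℝ) 1))).map fun p => p.1 / p.2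

instance : IsFiniteMeasure gaussianQuotient := by
  unfold gaussianQuotient
  infer_instance

lemma integral_div_sqrt {a : ℝ} (ha : 0 ≤ a) :
    ∫ r in (0 : ℝ)..1, r / √(r ^ 2 + a) = √(1 + a) - √a := by
  rcases ha.eq_or_lt with rfl | ha
  · have : ∫ r in (0 : ℝ)..1, r / √(r ^ 2 + 0) = ∫ r in (0 : ℝ)..1, (1 : ℝ) := by
      refine intervalIntegral.integral_congr_ae (ae_of_all _ fun r hr => ?_)
      rw [Set.uIoc_of_le zero_le_one] at hr
      rw [add_zero, Real.sqrt_sq hr.1.le, div_self hr.1.ne']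
    rw [this]
    simp
  · have hpos : ∀ r : ℝ, 0 < r ^ 2 + a := fun r => by positivity
    have hd : ∀ r ∈ Set.uIcc (0 : ℝ) 1,
        HasDerivAt (fun r : ℝ => √(r ^ 2 + a)) (r / √(r ^ 2 + a)) r := by
      intro r _
      convert ((hasDerivAt_pow 2 r).add_const a).sqrt (hpos r).ne' using 1
      push_cast
      rw [pow_one, mul_div_mul_left _ _ two_ne_zero]
    rw [intervalIntegral.integral_eq_sub_of_hasDerivAt hd]
    · simp
    · refine Continuous.intervalIntegrable ?_ _ _
      exact continuous_id.div (by fun_prop) fun r => (Real.sqrt_pos.2 (hpos r)).ne'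

lemma integral_exp_sq_gaussianQuotient {a : ℝ} (ha : 0 ≤ a) :
    ∫ z, Real.exp (-(a / 2) * z ^ 2) ∂gaussianQuotient = √(1 + a) - √a := by
  have hm : Measurable fun p : ℝ × ℝ => p.1 / p.2 := by fun_prop
  rw [gaussianQuotient, integral_map hm.aemeasurable (by fun_prop), integral_prod_symm,
    ← integral_div_sqrt ha, intervalIntegral.integral_of_le zero_le_one]
  · refine setIntegral_congr_fun measurableSet_Ioc fun r hr => ?_
    have hr0 : 0 < r := hr.1
    have h := integral_exp_sq_gaussianReal (a := a / r ^ 2) (by positivity)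
    have e : ∀ z : ℝ, Real.exp (-(a / 2) * (z / r) ^ 2)
        = Real.exp (-(a / r ^ 2 / 2) * z ^ 2) := fun z => by
      congr 1
      field_simp
    simp only [e, h]
    rw [show 1 + a / r ^ 2 = (r ^ 2 + a) / r ^ 2 by field_simp, Real.sqrt_div (by positivity),
      Real.sqrt_sq hr0.le, inv_div]
  · refine Integrable.of_bound (C := 1) (by fun_prop) (ae_of_all _ fun p => ?_)
    rw [Real.norm_of_nonneg (Real.exp_pos _).le, Real.exp_le_one_iff]
    nlinarith [mul_nonneg ha (sq_nonneg (p.1 / p.2))]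

lemma eN_sq {k : ℕ} (v : Fin k → ℝ) : eN v ^ 2 = ∑ i, v i ^ 2 :=
  Real.sq_sqrt (Finset.sum_nonneg fun _ _ => sq_nonneg _)

lemma integral_exp_inner_gaussian {k : ℕ} (a : Fin k → ℝ) (z : ℝ) :
    ∫ g, Complex.exp (-Complex.I * ((z * ∑ i, a i * g i : ℝ) : ℂ))
        ∂(Measure.pi fun _ : Fin k => gaussianReal 0 1)
      = (Real.exp (-(eN a ^ 2 / 2) * z ^ 2) : ℂ) := by
  have h1 : ∀ g : Fin k → ℝ, Complex.exp (-Complex.I * ((z * ∑ i, a i * g i : ℝ) : ℂ))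
      = ∏ i, Complex.exp (((-(z * a i) : ℝ) : ℂ) * (g i : ℂ) * Complex.I) := by
    intro g
    rw [← Complex.exp_sum]
    congr 1
    push_cast
    rw [Finset.mul_sum, Finset.mul_sum]
    exact Finset.sum_congr rfl fun i _ => by ring
  simp_rw [h1]
  rw [integral_fintype_prod_eq_prod
    (f := fun i (x : ℝ) => Complex.exp (((-(z * a i) : ℝ) : ℂ) * (x : ℂ) * Complex.I))]
  simp_rw [← charFun_apply_real, charFun_gaussianReal]
  rw [← Complex.exp_sum, eN_sq, Complex.ofReal_exp]
  congr 1
  push_cast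
  rw [Finset.sum_div, ← Finset.sum_neg_distrib, Finset.sum_mul]
  exact Finset.sum_congr rfl fun i _ => by ring

/-- Multiplication by a Gaussian mixture in a partial set of variables. -/
lemma IsWiener.mul_gaussian_mixture {n m k : ℕ} {f : ((Fin n → ℝ) × (Fin m → ℝ)) → ℂ}
    (hf : IsWiener f) {q : (Fin n → ℝ) × (Fin m → ℝ) → Fin k → ℝ}
    {j : (Fin k → ℝ) → (Fin n → ℝ) × (Fin m → ℝ)} (hj : Measurable j)
    (hqj : ∀ t g, phase t (j g) = ∑ i, q t i * g i) (κ : Measure ℝ) [IsFiniteMeasure κ] :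
    IsWiener (fun t => f t * ((∫ z, Real.exp (-(eN (q t) ^ 2 / 2) * z ^ 2) ∂κ : ℝ) : ℂ)) := by
  set γ : Measure (Fin k → ℝ) := Measure.pi fun _ => gaussianReal 0 1
  have hm : Measurable fun p : ℝ × (Fin k → ℝ) => j (p.1 • p.2) := hj.comp (by fun_prop)
  convert hf.mul_fourier_measure ((κ.prod γ).map fun p => j (p.1 • p.2)) using 3 with t
  rw [integral_map hm.aemeasurable, integral_prod, ← integral_complex_ofReal]
  · refine integral_congr_ae (ae_of_all _ fun z => ?_)
    simp only
    rw [← integral_exp_inner_gaussian]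
    refine integral_congr_ae (ae_of_all _ fun g => ?_)
    simp only [hqj, Pi.smul_apply, smul_eq_mul, Finset.mul_sum]
    simp only [mul_left_comm]
  · simpa using integrable_mul_exp (μ := κ.prod γ) (integrable_const (1 : ℂ)) t hm
  · have := continuous_phase t
    exact Continuous.aestronglyMeasurable (by fun_prop)

/-- If `f` and `|q|² f` belong to the Wiener algebra, so does `|q| f`, where `q` is one of the
two coordinate projections (as expressed by the section `j`). -/
lemma IsWiener.eN_mul {n m k : ℕ} {f : ((Fin n → ℝ) × (Fin m → ℝ)) → ℂ}
    {q : (Fin n → ℝ) × (Fin m → ℝ) → Fin k → ℝ}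
    {j : (Fin k → ℝ) → (Fin n → ℝ) × (Fin m → ℝ)} (hj : Measurable j)
    (hqj : ∀ t g, phase t (j g) = ∑ i, q t i * g i)
    (hf : IsWiener f) (hf2 : IsWiener fun t => ((eN (q t) ^ 2 : ℝ) : ℂ) * f t) :
    IsWiener fun t => ((eN (q t) : ℝ) : ℂ) * f t := by
  convert ((hf.add hf2).mul_gaussian_mixture hj hqj (gaussianReal 0 1)).sub
    (hf.mul_gaussian_mixture hj hqj gaussianQuotient) using 2 with t
  rw [integral_exp_sq_gaussianReal (sq_nonneg _), integral_exp_sq_gaussianQuotient (sq_nonneg _),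
    Real.sqrt_sq (show 0 ≤ eN (q t) from Real.sqrt_nonneg _)]
  have h : (1 + eN (q t) ^ 2) * (√(1 + eN (q t) ^ 2))⁻¹ = √(1 + eN (q t) ^ 2) := by
    rw [← div_eq_mul_inv, Real.div_sqrt]
  have h' := congrArg (fun x : ℝ => (x : ℂ)) h
  push_cast at h' ⊢
  linear_combination (-f t) * h'

/-- Smooth compactly supported functions belong to the Wiener algebra. -/
lemma isWiener_of_contDiff {n m : ℕ} {φ : ((Fin n → ℝ) × (Fin m → ℝ)) → ℂ}
    (hφ : ContDiff ℝ (⊤ : ℕ∞) φ) (hsupp : HasCompactSupport φ) : IsWiener φ := by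
  let V := WithLp 2 (EuclideanSpace ℝ (Fin n) × EuclideanSpace ℝ (Fin m))
  let e : V ≃L[ℝ] (Fin n → ℝ) × (Fin m → ℝ) :=
    (WithLp.prodContinuousLinearEquiv 2 ℝ (EuclideanSpace ℝ (Fin n))
      (EuclideanSpace ℝ (Fin m))).trans
      ((EuclideanSpace.equiv (Fin n) ℝ).prodCongr (EuclideanSpace.equiv (Fin m) ℝ))
  have he : MeasurePreserving e :=
    ((PiLp.volume_preserving_ofLp (Fin n)).prod (PiLp.volume_preserving_ofLp (Fin m))).comp
      (WithLp.volume_preserving_ofLp (EuclideanSpace ℝ (Fin n)) (EuclideanSpace ℝ (Fin m)))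
  have hemb : MeasurableEmbedding e := e.toHomeomorph.measurableEmbedding
  have h2π : (2 * Real.pi) ≠ 0 := by positivity
  let s : V ≃L[ℝ] (Fin n → ℝ) × (Fin m → ℝ) :=
    (ContinuousLinearEquiv.smulLeft (Units.mk0 (2 * Real.pi) h2π)).trans e
  have hs : ∀ v, s v = (2 * Real.pi) • e v := fun v =>
    map_smul e (2 * Real.pi) v
  let F : SchwartzMap V ℂ := HasCompactSupport.toSchwartzMap (f := φ ∘ s)
    (hsupp.comp_homeomorph s.toHomeomorph) (hφ.comp s.contDiff)
  let G : SchwartzMap V ℂ := FourierTransformInv.fourierInv F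
  have hG : ∀ v, φ (s v) = ∫ w, Complex.exp (((-2 * Real.pi * inner ℝ w v : ℝ) : ℂ) * Complex.I)
      • G w := by
    intro v
    rw [← Real.fourier_eq', ← SchwartzMap.fourier_coe, FourierTransform.fourier_fourierInv_eq]
    rfl
  refine ⟨fun x => G (e.symm x), ?_, fun t => ?_⟩
  · rw [← he.integrable_comp_emb hemb]
    simpa [Function.comp_def] using G.integrable
  · obtain ⟨v, rfl⟩ := s.surjective t
    rw [hG, ft_eq, ← he.integral_comp hemb]
    refine integral_congr_ae (ae_of_all _ fun w => ?_)
    have hin : phase (s v) (e w) = 2 * Real.pi * inner ℝ w v := by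
      rw [hs, WithLp.prod_inner_apply, PiLp.inner_apply, PiLp.inner_apply]
      simp only [phase, mul_add, Finset.mul_sum]
      congr 1 <;> exact Finset.sum_congr rfl fun i _ => mul_assoc _ _ _
    simp only [smul_eq_mul, e.symm_apply_apply, hin]
    rw [mul_comm]
    congr 2
    push_cast
    ring

/-- If `φ ∈ C_c^∞(ℝ^{n+m})`, then the functions `|x|φ(x,y)`, `|y|φ(x,y)`
and `|x||y|φ(x,y)` all belong to the Wiener algebra `W₀(ℝ^{n+m})`, i.e. each is the Fourier
transform of an integrable function. -/
theorem modulus_multiplication_wiener (n m : ℕ)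
    (φ : ((Fin n → ℝ) × (Fin m → ℝ)) → ℂ)
    (hφ : ContDiff ℝ (⊤ : ℕ∞) φ) (hsupp : HasCompactSupport φ) :
    (∃ ρ : ((Fin n → ℝ) × (Fin m → ℝ)) → ℂ, Integrable ρ ∧
      ∀ t, ((eN t.1 : ℝ) : ℂ) * φ t = ft ρ t) ∧
    (∃ ρ : ((Fin n → ℝ) × (Fin m → ℝ)) → ℂ, Integrable ρ ∧
      ∀ t, ((eN t.2 : ℝ) : ℂ) * φ t = ft ρ t) ∧
    (∃ ρ : ((Fin n → ℝ) × (Fin m → ℝ)) → ℂ, Integrable ρ ∧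
      ∀ t, ((eN t.1 * eN t.2 : ℝ) : ℂ) * φ t = ft ρ t) := by
  have hx : ContDiff ℝ (⊤ : ℕ∞) fun t : (Fin n → ℝ) × (Fin m → ℝ) => ((eN t.1 ^ 2 : ℝ) : ℂ) := by
    simp only [eN_sq]
    have : ContDiff ℝ (⊤ : ℕ∞) fun t : (Fin n → ℝ) × (Fin m → ℝ) => ∑ i, t.1 i ^ 2 :=
      ContDiff.sum fun i _ => by fun_prop
    exact Complex.ofRealCLM.contDiff.comp this
  have hy : ContDiff ℝ (⊤ : ℕ∞) fun t : (Fin n → ℝ) × (Fin m → ℝ) => ((eN t.2 ^ 2 : ℝ) : ℂ) := by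
    simp only [eN_sq]
    have : ContDiff ℝ (⊤ : ℕ∞) fun t : (Fin n → ℝ) × (Fin m → ℝ) => ∑ i, t.2 i ^ 2 :=
      ContDiff.sum fun i _ => by fun_prop
    exact Complex.ofRealCLM.contDiff.comp this
  have hfst : ∀ (t : (Fin n → ℝ) × (Fin m → ℝ)) (g : Fin n → ℝ),
      phase t (g, 0) = ∑ i, t.1 i * g i := fun t g => by simp [phase]
  have hsnd : ∀ (t : (Fin n → ℝ) × (Fin m → ℝ)) (g : Fin m → ℝ),
      phase t (0, g) = ∑ i, t.2 i * g i := fun t g => by simp [phase]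
  have mfst : Measurable fun g : Fin n → ℝ => (g, (0 : Fin m → ℝ)) := by fun_prop
  have msnd : Measurable fun g : Fin m → ℝ => ((0 : Fin n → ℝ), g) := by fun_prop
  have w : IsWiener φ := isWiener_of_contDiff hφ hsupp
  have wy2 := isWiener_of_contDiff (hy.mul hφ) hsupp.mul_left
  have wx : IsWiener fun t => ((eN t.1 : ℝ) : ℂ) * φ t :=
    w.eN_mul mfst hfst (isWiener_of_contDiff (hx.mul hφ) hsupp.mul_left)
  have wxy2 : IsWiener fun t => ((eN t.1 : ℝ) : ℂ) * (((eN t.2 ^ 2 : ℝ) : ℂ) * φ t) :=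
    wy2.eN_mul mfst hfst
      (isWiener_of_contDiff (hx.mul (hy.mul hφ)) (hsupp.mul_left.mul_left))
  refine ⟨wx, w.eN_mul msnd hsnd wy2, ?_⟩
  have wxy := wx.eN_mul msnd hsnd (by simpa only [mul_left_comm] using wxy2)
  change IsWiener fun t => ((eN t.1 * eN t.2 : ℝ) : ℂ) * φ t
  convert wxy using 2 with t
  push_cast
  ring

end TwoWeightBMO
end
end

section
/- Let 1<p<∞ and let E⊆ℝ^N be a bounded measurable set of positive measure. Let W:E→M_d(ℂ) take a.e. positive-definite values with both W and W'=W^{−1/(p−1)} integrable over E, and set C_E := ⨍_E (⨍_E |W(x)^{1/p}W(y)^{−1/p}|^{p'} dy)^{p/p'} dx, p'=p/(p−1). Let 𝒲_E be a reducing operator of W over E with respect to p and 𝒲'_E a reducing operator of W' over E with respect to p'. Then: (1) |𝒲_E^{−1}e| ≤ |𝒲'_E e| ≤ c_{p,d}·C_E^{1/p}·|𝒲_E^{−1}e| for all e∈ℂ^d; and (2) |⟨W^{1/p}⟩_E e| ≤ |𝒲_E e| ≤ c'_{p,d}·C_E^{d/p}·|⟨W^{1/p}⟩_E e| for all e∈ℂ^d,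 where c_{p,d}, c'_{p,d} depend only on p and d and ⟨W^{1/p}⟩_E denotes the average of W^{1/p} over E. -/
open MeasureTheory Filter
open scoped ENNReal ComplexOrder

noncomputable section

namespace TwoWeightBMO


open scoped Matrix.Norms.L2Operator MatrixOrder Matrix Nat

section LinearAlgebra

variable {d : ℕ}

lemma vNorm_eq (v : Fin d → ℂ) : vNorm d v = ‖WithLp.toLp 2 v‖ := rfl

lemma vNorm_nonneg (v : Fin d → ℂ) : 0 ≤ vNorm d v := norm_nonneg _

lemma continuous_vNorm : Continuous (vNorm d) :=
  continuous_norm.comp (PiLp.continuous_toLp 2 _)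

lemma vNorm_mulVec_le (A : Matrix (Fin d) (Fin d) ℂ) (v : Fin d → ℂ) :
    vNorm d (A *ᵥ v) ≤ ‖A‖ * vNorm d v :=
  Matrix.l2_opNorm_mulVec A (WithLp.toLp 2 v)

lemma norm_le_of_vNorm_mulVec_le {A : Matrix (Fin d) (Fin d) ℂ} {K : ℝ} (hK : 0 ≤ K)
    (h : ∀ v, vNorm d (A *ᵥ v) ≤ K * vNorm d v) : ‖A‖ ≤ K :=
  ContinuousLinearMap.opNorm_le_bound _ hK fun v => h v.ofLp

lemma norm_apply_le_vNorm (v : Fin d → ℂ) (i : Fin d) : ‖v i‖ ≤ vNorm d v :=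
  PiLp.norm_apply_le (WithLp.toLp 2 v) i

lemma vNorm_single (i : Fin d) : vNorm d (Pi.single i 1) = 1 := by
  rw [vNorm_eq]; simp

lemma vNorm_sum_le {ι : Type*} (s : Finset ι) (v : ι → Fin d → ℂ) :
    vNorm d (∑ i ∈ s, v i) ≤ ∑ i ∈ s, vNorm d (v i) := by
  simp only [vNorm_eq, WithLp.toLp_sum]
  exact norm_sum_le _ _

lemma vNorm_smul (c : ℂ) (v : Fin d → ℂ) : vNorm d (c • v) = ‖c‖ * vNorm d v := by
  rw [vNorm_eq, WithLp.toLp_smul, norm_smul, vNorm_eq]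

lemma vNorm_le_sum (v : Fin d → ℂ) : vNorm d v ≤ ∑ i, ‖v i‖ := by
  conv_lhs => rw [pi_eq_sum_univ' v]
  refine (vNorm_sum_le _ _).trans (Finset.sum_le_sum fun i _ => ?_)
  rw [vNorm_smul, vNorm_single, mul_one]

lemma norm_apply_le_norm (A : Matrix (Fin d) (Fin d) ℂ) (i j : Fin d) : ‖A i j‖ ≤ ‖A‖ := by
  have h := (norm_apply_le_vNorm (A *ᵥ Pi.single j 1) i).trans (vNorm_mulVec_le _ _)
  simpa [vNorm_single] using h

lemma norm_le_sum_vNorm_col (A : Matrix (Fin d) (Fin d) ℂ) :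
    ‖A‖ ≤ ∑ j, vNorm d (A *ᵥ Pi.single j 1) := by
  refine norm_le_of_vNorm_mulVec_le (Finset.sum_nonneg fun _ _ => vNorm_nonneg _) fun v => ?_
  have hv : A *ᵥ v = ∑ j, v j • (A *ᵥ Pi.single j 1) := by
    ext i; simp [Matrix.mulVec, dotProduct, mul_comm]
  rw [hv, Finset.sum_mul]
  refine (vNorm_sum_le _ _).trans (Finset.sum_le_sum fun j _ => ?_)
  rw [vNorm_smul, mul_comm]
  exact mul_le_mul_of_nonneg_left (norm_apply_le_vNorm _ _) (vNorm_nonneg _)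

lemma norm_le_of_apply_le {A : Matrix (Fin d) (Fin d) ℂ} {K : ℝ} (h : ∀ i j, ‖A i j‖ ≤ K) :
    ‖A‖ ≤ d * (d * K) := by
  refine (norm_le_sum_vNorm_col A).trans ?_
  refine (Finset.sum_le_sum (g := fun _ => d * K) fun j _ => ?_).trans (by simp)
  refine (vNorm_le_sum _).trans ?_
  refine (Finset.sum_le_sum (g := fun _ => K) fun i _ => ?_).trans (by simp)
  simpa using h i j

lemma norm_det_le_of_apply_le {A : Matrix (Fin d) (Fin d) ℂ} {K : ℝ} (h : ∀ i j, ‖A i j‖ ≤ K) :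
    ‖A.det‖ ≤ d ! * K ^ d := by
  have := Matrix.det_le (A := A) (abv := NormedField.toAbsoluteValue ℂ) (x := K) h
  rw [Fintype.card_fin, nsmul_eq_mul] at this
  exact this

lemma norm_adjugate_le {A : Matrix (Fin d) (Fin d) ℂ} (h : ‖A‖ ≤ 1) :
    ‖A.adjugate‖ ≤ d * (d * d !) := by
  refine norm_le_of_apply_le fun i j => ?_
  rw [Matrix.adjugate_apply]
  refine (norm_det_le_of_apply_le (K := 1) fun k l => ?_).trans (by simp)
  rw [Matrix.updateRow_apply]
  split_ifs
  · rw [Pi.single_apply]; split_ifs <;> simp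
  · exact (norm_apply_le_norm A k l).trans h

lemma norm_star_dotProduct_le (e f : Fin d → ℂ) :
    ‖star e ⬝ᵥ f‖ ≤ vNorm d e * vNorm d f := by
  have := norm_inner_le_norm (𝕜 := ℂ) (WithLp.toLp 2 e) (WithLp.toLp 2 f)
  rwa [EuclideanSpace.inner_toLp_toLp, dotProduct_comm] at this

lemma re_star_dotProduct_self (e : Fin d → ℂ) : (star e ⬝ᵥ e).re = vNorm d e ^ 2 := by
  have := inner_self_eq_norm_sq (𝕜 := ℂ) (WithLp.toLp 2 e)
  rwa [EuclideanSpace.inner_toLp_toLp, dotProduct_comm] at this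

lemma one_le_norm_det_mul_norm_det {A B : Matrix (Fin d) (Fin d) ℂ} (hA : A.PosDef)
    (hB : B.PosDef)
    (h : ∀ e f : Fin d → ℂ, 2 * (star e ⬝ᵥ f).re
      ≤ (star e ⬝ᵥ A *ᵥ e).re + (star f ⬝ᵥ B *ᵥ f).re) :
    1 ≤ (d ! : ℝ) ^ 2 * (‖A.det‖ * ‖B.det‖) := by
  obtain ⟨P, hP⟩ := CStarAlgebra.nonneg_iff_eq_star_mul_self.1
    (Matrix.nonneg_iff_posSemidef.2 hA.posSemidef)
  obtain ⟨Q, hQ⟩ := CStarAlgebra.nonneg_iff_eq_star_mul_self.1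
    (Matrix.nonneg_iff_posSemidef.2 hB.posSemidef)
  have key : ∀ (A P : Matrix (Fin d) (Fin d) ℂ), A.PosDef → A = star P * P →
      IsUnit P.det ∧ ‖A.det‖ = ‖P.det‖ ^ 2 ∧
        ∀ v, (star (P⁻¹ *ᵥ v) ⬝ᵥ A *ᵥ (P⁻¹ *ᵥ v)).re = vNorm d v ^ 2 := by
    intro A P hA hAP
    have hdet : A.det = star P.det * P.det := by
      rw [hAP, Matrix.det_mul, Matrix.star_eq_conjTranspose, Matrix.det_conjTranspose]
    have hP : IsUnit P.det := by
      refine isUnit_iff_ne_zero.2 fun h0 => hA.det_pos.ne' ?_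
      rw [hdet, h0, mul_zero]
    refine ⟨hP, by rw [hdet, norm_mul, norm_star, sq], fun v => ?_⟩
    rw [← re_star_dotProduct_self, hAP, ← Matrix.mulVec_mulVec, Matrix.mulVec_mulVec v P P⁻¹,
      Matrix.mul_nonsing_inv P hP, Matrix.one_mulVec, Matrix.star_eq_conjTranspose,
      Matrix.dotProduct_mulVec, ← Matrix.star_mulVec, Matrix.mulVec_mulVec,
      Matrix.mul_nonsing_inv P hP, Matrix.one_mulVec]
  obtain ⟨hPu, hPd, hPv⟩ := key A P hA hP
  obtain ⟨hQu, hQd, hQv⟩ := key B Q hB hQ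
  have hent : ∀ i j, ‖((P⁻¹)ᴴ * Q⁻¹) i j‖ ≤ 1 := by
    intro i j
    set z := ((P⁻¹)ᴴ * Q⁻¹) i j with hz
    have hzij : z = star (P⁻¹ *ᵥ Pi.single i 1) ⬝ᵥ (Q⁻¹ *ᵥ Pi.single j 1) := by
      rw [Matrix.star_mulVec, ← Matrix.dotProduct_mulVec, Matrix.mulVec_mulVec]
      simp [hz]
    obtain ⟨c, hc, hcz⟩ : ∃ c : ℂ, ‖c‖ = 1 ∧ c * z = ‖z‖ := by
      by_cases h0 : z = 0
      · exact ⟨1, by simp, by simp [h0]⟩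
      · have hn : (‖z‖ : ℂ) ≠ 0 := by simpa using h0
        exact ⟨‖z‖ / z, by simp [h0], by field_simp⟩
    have h1 := h (P⁻¹ *ᵥ Pi.single i 1) (Q⁻¹ *ᵥ (c • Pi.single j 1))
    rw [hPv, hQv, vNorm_single, vNorm_smul, vNorm_single, hc, Matrix.mulVec_smul,
      dotProduct_smul, ← hzij, smul_eq_mul, hcz, Complex.ofReal_re] at h1
    linarith
  have hdet := norm_det_le_of_apply_le hent
  rw [Matrix.det_mul, Matrix.det_conjTranspose, norm_mul, norm_star, one_pow, mul_one,
    Matrix.det_nonsing_inv, Matrix.det_nonsing_inv, Ring.inverse_eq_inv',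
    norm_inv, norm_inv, ← mul_inv] at hdet
  have hpos : 0 < ‖P.det‖ * ‖Q.det‖ :=
    mul_pos (norm_pos_iff.2 hPu.ne_zero) (norm_pos_iff.2 hQu.ne_zero)
  have h2 : 1 ≤ d ! * (‖P.det‖ * ‖Q.det‖) := by
    rwa [inv_le_iff_one_le_mul₀ hpos] at hdet
  calc (1 : ℝ) ≤ (d ! * (‖P.det‖ * ‖Q.det‖)) ^ 2 := one_le_pow₀ h2
    _ = _ := by rw [hPd, hQd]; ring

lemma two_mul_re_dotProduct_le {S T : Matrix (Fin d) (Fin d) ℂ} (hS : S.PosDef)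
    (hT : T.PosDef) (hST : S * T = 1) (e f : Fin d → ℂ) :
    2 * (star e ⬝ᵥ f).re ≤ (star e ⬝ᵥ S *ᵥ e).re + (star f ⬝ᵥ T *ᵥ f).re := by
  have h := hS.posSemidef.re_dotProduct_nonneg (e - T *ᵥ f)
  have h1 : S *ᵥ (e - T *ᵥ f) = S *ᵥ e - f := by
    rw [Matrix.mulVec_sub, Matrix.mulVec_mulVec, hST, Matrix.one_mulVec]
  have hTS : T * S = 1 := mul_eq_one_comm.1 hST
  have h2 : star (T *ᵥ f) ⬝ᵥ S *ᵥ e = star f ⬝ᵥ e := by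
    rw [Matrix.star_mulVec, hT.isHermitian.eq, ← Matrix.dotProduct_mulVec, Matrix.mulVec_mulVec,
      hTS, Matrix.one_mulVec]
  have h3 : star (T *ᵥ f) ⬝ᵥ f = star f ⬝ᵥ T *ᵥ f := by
    rw [Matrix.star_mulVec, hT.isHermitian.eq, ← Matrix.dotProduct_mulVec]
  have h4 : (star f ⬝ᵥ e).re = (star e ⬝ᵥ f).re := by
    rw [← Complex.conj_re, ← RCLike.star_def, Matrix.star_dotProduct, star_star, dotProduct_comm]
  rw [h1, star_sub, sub_dotProduct, dotProduct_sub, dotProduct_sub, h2, h3] at h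
  simp only [RCLike.re_to_complex, Complex.sub_re, h4] at h
  linarith

end LinearAlgebra

section MatrixPower

variable {d : ℕ}

lemma pos_of_mem_spectrum {A : Matrix (Fin d) (Fin d) ℂ} (hA : A.PosDef) {x : ℝ}
    (hx : x ∈ spectrum ℝ A) : 0 < x := by
  rw [hA.isHermitian.spectrum_real_eq_range_eigenvalues] at hx
  obtain ⟨i, rfl⟩ := hx
  exact hA.eigenvalues_pos i

lemma continuousOn_rpow_spectrum {A : Matrix (Fin d) (Fin d) ℂ} (hA : A.PosDef) (t : ℝ) :
    ContinuousOn (fun x : ℝ => x ^ t) (spectrum ℝ A) := fun _ hx =>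
  (Real.continuousAt_rpow_const _ _ (Or.inl (pos_of_mem_spectrum hA hx).ne')).continuousWithinAt

lemma posDef_matRpow {A : Matrix (Fin d) (Fin d) ℂ} (hA : A.PosDef) (t : ℝ) :
    (matRpow A t).PosDef := by
  have hc := continuousOn_rpow_spectrum hA t
  have hH : (matRpow A t).IsHermitian := cfc_predicate (fun x : ℝ => x ^ t) A
  rw [hH.posDef_iff_eigenvalues_pos]
  intro i
  have hi : hH.eigenvalues i ∈ spectrum ℝ (cfc (fun x : ℝ => x ^ t) A) :=
    hH.eigenvalues_mem_spectrum_real i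
  rw [cfc_map_spectrum _ _ hA.isHermitian.isSelfAdjoint hc] at hi
  obtain ⟨x, hx, hxi⟩ := hi
  rw [← hxi]
  exact Real.rpow_pos_of_pos (pos_of_mem_spectrum hA hx) t

lemma matRpow_mul_matRpow_neg {A : Matrix (Fin d) (Fin d) ℂ} (hA : A.PosDef) (t : ℝ) :
    matRpow A t * matRpow A (-t) = 1 := by
  have hs : IsSelfAdjoint A := hA.isHermitian.isSelfAdjoint
  rw [matRpow, matRpow, ← cfc_mul _ _ A (continuousOn_rpow_spectrum hA t)
    (continuousOn_rpow_spectrum hA (-t)), ← cfc_one ℝ A hs]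
  refine cfc_congr fun x hx => ?_
  have h0 := pos_of_mem_spectrum hA hx
  simp [← Real.rpow_add h0]

lemma matRpow_matRpow {A : Matrix (Fin d) (Fin d) ℂ} (hA : A.PosDef) (s t : ℝ) :
    matRpow (matRpow A s) t = matRpow A (s * t) := by
  have hs : IsSelfAdjoint A := hA.isHermitian.isSelfAdjoint
  unfold matRpow
  rw [← cfc_comp' (fun x : ℝ => x ^ t) (fun x : ℝ => x ^ s) A ?_
    (continuousOn_rpow_spectrum hA s)]
  · refine cfc_congr fun x hx => ?_
    exact (Real.rpow_mul (pos_of_mem_spectrum hA hx).le s t).symm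
  · rintro _ ⟨x, hx, rfl⟩
    exact (Real.continuousAt_rpow_const _ _ (Or.inl
      (Real.rpow_pos_of_pos (pos_of_mem_spectrum hA hx) s).ne')).continuousWithinAt

lemma norm_matRpow_one_div_rpow_le {A : Matrix (Fin d) (Fin d) ℂ} (hA : A.PosDef) {p : ℝ}
    (hp : 0 < p) : ‖matRpow A (1 / p)‖ ^ p ≤ ‖A‖ := by
  have hs : IsSelfAdjoint A := hA.isHermitian.isSelfAdjoint
  have h : ‖matRpow A (1 / p)‖ ≤ ‖A‖ ^ (1 / p) := by
    refine norm_cfc_le (by positivity) fun x hx => ?_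
    have h0 := pos_of_mem_spectrum hA hx
    rw [Real.norm_of_nonneg (by positivity)]
    refine Real.rpow_le_rpow h0.le ?_ (by positivity)
    have h1 := norm_apply_le_norm_cfc (fun x : ℝ => x) A hx continuousOn_id hs
    rw [cfc_id' ℝ A hs] at h1
    exact (le_abs_self x).trans h1
  calc ‖matRpow A (1 / p)‖ ^ p ≤ (‖A‖ ^ (1 / p)) ^ p :=
        Real.rpow_le_rpow (norm_nonneg _) h hp.le
    _ = ‖A‖ := by rw [← Real.rpow_mul (norm_nonneg _), one_div_mul_cancel hp.ne', Real.rpow_one]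

lemma measurableSet_posDef :
    MeasurableSet[borel _] {A : Matrix (Fin d) (Fin d) ℂ | A.PosDef} := by
  have hcl : IsClosed {A : Matrix (Fin d) (Fin d) ℂ | 0 ≤ A} := CStarAlgebra.isClosed_nonneg
  have hop : IsOpen {A : Matrix (Fin d) (Fin d) ℂ | A.det ≠ 0} :=
    isOpen_ne_fun (continuous_id.matrix_det) continuous_const
  have : {A : Matrix (Fin d) (Fin d) ℂ | A.PosDef} = {A | 0 ≤ A} ∩ {A | A.det ≠ 0} := by
    ext A
    refine ⟨fun h => ⟨Matrix.nonneg_iff_posSemidef.2 h.posSemidef, h.det_pos.ne'⟩, fun h => ?_⟩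
    exact (Matrix.nonneg_iff_posSemidef.1 h.1).posDef_iff_det_ne_zero.2 h.2
  let _ : MeasurableSpace (Matrix (Fin d) (Fin d) ℂ) := borel _
  have _ : BorelSpace (Matrix (Fin d) (Fin d) ℂ) := ⟨rfl⟩
  rw [this]
  exact hcl.measurableSet.inter hop.measurableSet

lemma continuousOn_matRpow (t : ℝ) :
    ContinuousOn (fun A : Matrix (Fin d) (Fin d) ℂ => matRpow A t) {A | A.PosDef} := by
  refine ContinuousOn.cfc_of_mem_nhdsSet (s := Set.Ioi 0) (fun x : ℝ => x ^ t) ?_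
    continuousOn_id (fun A hA => hA.isHermitian.isSelfAdjoint)
    (fun x hx => (Real.continuousAt_rpow_const _ _ (Or.inl (ne_of_gt hx))).continuousWithinAt)
  rw [isOpen_Ioi.mem_nhdsSet]
  exact Set.iUnion₂_subset fun A hA x hx => pos_of_mem_spectrum hA hx

lemma aestronglyMeasurable_matRpow {X : Type*} [MeasurableSpace X] {μ : Measure X}
    {W : X → Matrix (Fin d) (Fin d) ℂ} (hW : ∀ᵐ x ∂μ, (W x).PosDef)
    (hm : ∀ i j, AEStronglyMeasurable (fun x => W x i j) μ) (t : ℝ) :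
    AEStronglyMeasurable (fun x => matRpow (W x) t) μ := by
  let _ : MeasurableSpace (Matrix (Fin d) (Fin d) ℂ) := borel _
  have _ : BorelSpace (Matrix (Fin d) (Fin d) ℂ) := ⟨rfl⟩
  classical
  have hWm : AEStronglyMeasurable W μ := by
    have : W = fun x => ∑ i, ∑ j, W x i j • Matrix.single i j (1 : ℂ) := by
      ext x : 1
      conv_lhs => rw [Matrix.matrix_eq_sum_single (W x)]
      simp [Matrix.smul_single]
    rw [this]
    refine Finset.aestronglyMeasurable_fun_sum _ fun i _ =>
      Finset.aestronglyMeasurable_fun_sum _ fun j _ => (hm i j).smul_const _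
  have hpw : Measurable ({A : Matrix (Fin d) (Fin d) ℂ | A.PosDef}.piecewise
      (fun A => matRpow A t) fun _ => 0) :=
    ContinuousOn.measurable_piecewise (continuousOn_matRpow t) continuousOn_const
      measurableSet_posDef
  refine (hpw.comp_aemeasurable hWm.aemeasurable).aestronglyMeasurable.congr ?_
  filter_upwards [hW] with x hx
  exact Set.piecewise_eq_of_mem _ _ _ hx

end MatrixPower

section DualPair

variable {d : ℕ} {X : Type*} [MeasurableSpace X] {μ : Measure X} {p q : ℝ}
  {S T : X → Matrix (Fin d) (Fin d) ℂ} {M M' : Matrix (Fin d) (Fin d) ℂ}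

/-- `S` and `T` are a.e. positive definite and inverse to each other, with `S` in `L^p` and `T`
in `L^q`. -/
structure IsDualPair (μ : Measure X) (p q : ℝ) (S T : X → Matrix (Fin d) (Fin d) ℂ) : Prop where
  posDef_left : ∀ᵐ x ∂μ, (S x).PosDef
  posDef_right : ∀ᵐ x ∂μ, (T x).PosDef
  mul_eq_one : ∀ᵐ x ∂μ, S x * T x = 1
  aesm_left : AEStronglyMeasurable S μ
  aesm_right : AEStronglyMeasurable T μ
  integrable_left : Integrable (fun x => ‖S x‖ ^ p) μ
  integrable_right : Integrable (fun x => ‖T x‖ ^ q) μ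

/-- `M` is comparable to the `L^p(μ)` average of `S`. -/
def IsReducingFor (μ : Measure X) (p : ℝ) (S : X → Matrix (Fin d) (Fin d) ℂ)
    (M : Matrix (Fin d) (Fin d) ℂ) : Prop :=
  M.PosDef ∧ ∀ e : Fin d → ℂ,
    (∫ x, vNorm d (S x *ᵥ e) ^ p ∂μ) ^ (1 / p) ≤ vNorm d (M *ᵥ e) ∧
      vNorm d (M *ᵥ e) ≤ √d * (∫ x, vNorm d (S x *ᵥ e) ^ p ∂μ) ^ (1 / p)

/-- The entrywise integral of a matrix-valued function. -/
def matIntegral (μ : Measure X) (S : X → Matrix (Fin d) (Fin d) ℂ) :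
    Matrix (Fin d) (Fin d) ℂ :=
  Matrix.of fun i j => ∫ x, S x i j ∂μ

lemma IsDualPair.symm (h : IsDualPair μ p q S T) : IsDualPair μ q p T S :=
  ⟨h.posDef_right, h.posDef_left, h.mul_eq_one.mono fun _ => mul_eq_one_comm.1,
    h.aesm_right, h.aesm_left, h.integrable_right, h.integrable_left⟩

lemma IsDualPair.memLp_norm (h : IsDualPair μ p q S T) (hp : 0 < p) :
    MemLp (fun x => ‖S x‖) (ENNReal.ofReal p) μ := by
  rw [← integrable_norm_rpow_iff h.aesm_left.norm (by simpa using hp) ENNReal.ofReal_ne_top]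
  simpa [ENNReal.toReal_ofReal hp.le] using h.integrable_left

lemma aestronglyMeasurable_vNorm_mulVec (h : AEStronglyMeasurable S μ) (e : Fin d → ℂ) :
    AEStronglyMeasurable (fun x => vNorm d (S x *ᵥ e)) μ :=
  (continuous_vNorm.comp (continuous_id.matrix_mulVec continuous_const)).comp_aestronglyMeasurable h

lemma IsDualPair.memLp_vNorm (h : IsDualPair μ p q S T) (hp : 0 < p) (e : Fin d → ℂ) :
    MemLp (fun x => vNorm d (S x *ᵥ e)) (ENNReal.ofReal p) μ := by
  refine (h.memLp_norm hp).of_le_mul (c := vNorm d e)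
    (aestronglyMeasurable_vNorm_mulVec h.aesm_left e) (Eventually.of_forall fun x => ?_)
  rw [Real.norm_of_nonneg (vNorm_nonneg _), norm_norm, mul_comm]
  exact vNorm_mulVec_le _ _

lemma matIntegral_mulVec (hS : ∀ i j, Integrable (fun x => S x i j) μ) (e : Fin d → ℂ)
    (i : Fin d) : (matIntegral μ S *ᵥ e) i = ∫ x, (S x *ᵥ e) i ∂μ := by
  simp only [matIntegral, Matrix.mulVec, dotProduct, Matrix.of_apply]
  rw [integral_finsetSum _ fun j _ => (hS i j).mul_const _]
  simp only [integral_mul_const]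

lemma integrable_mulVec_apply (hS : ∀ i j, Integrable (fun x => S x i j) μ) (e : Fin d → ℂ)
    (i : Fin d) : Integrable (fun x => (S x *ᵥ e) i) μ := by
  simp only [Matrix.mulVec, dotProduct]
  exact integrable_finsetSum _ fun j _ => (hS i j).mul_const _

lemma integrable_dotProduct_mulVec (hS : ∀ i j, Integrable (fun x => S x i j) μ)
    (e f : Fin d → ℂ) : Integrable (fun x => e ⬝ᵥ S x *ᵥ f) μ := by
  simp only [dotProduct]
  exact integrable_finsetSum _ fun j _ => (integrable_mulVec_apply hS f j).const_mul _

lemma dotProduct_matIntegral_mulVec (hS : ∀ i j, Integrable (fun x => S x i j) μ)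
    (e f : Fin d → ℂ) : e ⬝ᵥ matIntegral μ S *ᵥ f = ∫ x, e ⬝ᵥ S x *ᵥ f ∂μ := by
  simp only [dotProduct, matIntegral_mulVec hS]
  rw [integral_finsetSum _ fun j _ => (integrable_mulVec_apply hS f j).const_mul _]
  simp only [integral_const_mul]

lemma re_dotProduct_matIntegral_mulVec (hS : ∀ i j, Integrable (fun x => S x i j) μ)
    (e f : Fin d → ℂ) :
    (e ⬝ᵥ matIntegral μ S *ᵥ f).re = ∫ x, (e ⬝ᵥ S x *ᵥ f).re ∂μ := by
  rw [dotProduct_matIntegral_mulVec hS]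
  exact (integral_re (𝕜 := ℂ) (integrable_dotProduct_mulVec hS e f)).symm

lemma vNorm_matIntegral_mulVec_le (hS : ∀ i j, Integrable (fun x => S x i j) μ)
    (e : Fin d → ℂ) : vNorm d (matIntegral μ S *ᵥ e) ≤ ∫ x, vNorm d (S x *ᵥ e) ∂μ := by
  have : WithLp.toLp 2 (matIntegral μ S *ᵥ e) = ∫ x, WithLp.toLp 2 (S x *ᵥ e) ∂μ := by
    ext i
    rw [eval_integral_piLp fun i => integrable_mulVec_apply hS e i]
    exact matIntegral_mulVec hS e i
  rw [vNorm_eq, this]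
  exact norm_integral_le_integral_norm _

lemma IsDualPair.integrable_norm_mul_rpow (h : IsDualPair μ p q S T) (hq : 0 < q)
    (A : Matrix (Fin d) (Fin d) ℂ) : Integrable (fun y => ‖A * T y‖ ^ q) μ := by
  refine (h.integrable_right.const_mul (‖A‖ ^ q)).mono'
    ((continuous_norm.rpow_const fun _ => Or.inr hq.le).comp_aestronglyMeasurable
      (h.aesm_right.const_mul A)) (Eventually.of_forall fun y => ?_)
  rw [Real.norm_of_nonneg (by positivity), ← Real.mul_rpow (norm_nonneg _) (norm_nonneg _)]
  exact Real.rpow_le_rpow (norm_nonneg _) (norm_mul_le _ _) hq.le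

lemma integral_integral_norm_mul_rpow_nonneg :
    0 ≤ ∫ x, (∫ y, ‖S x * T y‖ ^ q ∂μ) ^ (p / q) ∂μ :=
  integral_nonneg fun _ => Real.rpow_nonneg (integral_nonneg fun _ => by positivity) _

lemma norm_mul_comm_of_isHermitian {A B : Matrix (Fin d) (Fin d) ℂ} (hA : A.IsHermitian)
    (hB : B.IsHermitian) : ‖A * B‖ = ‖B * A‖ := by
  rw [← Matrix.l2_opNorm_conjTranspose, Matrix.conjTranspose_mul, hA.eq, hB.eq]

lemma IsDualPair.norm_mul_le_integral (h : IsDualPair μ p q S T) (hq : 0 < q)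
    (hM' : IsReducingFor μ q T M') {A : Matrix (Fin d) (Fin d) ℂ} (hA : A.IsHermitian) :
    ‖A * M'‖ ≤ d * (√d * (∫ y, ‖A * T y‖ ^ q ∂μ) ^ (1 / q)) := by
  rw [norm_mul_comm_of_isHermitian hA hM'.1.isHermitian]
  refine (norm_le_sum_vNorm_col _).trans ?_
  have key : ∀ j : Fin d, vNorm d ((M' * A) *ᵥ Pi.single j 1) ≤
      √d * (∫ y, ‖A * T y‖ ^ q ∂μ) ^ (1 / q) := by
    intro j
    rw [← Matrix.mulVec_mulVec]
    refine (hM'.2 _).2.trans (mul_le_mul_of_nonneg_left (Real.rpow_le_rpow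
      (integral_nonneg fun _ => Real.rpow_nonneg (vNorm_nonneg _) _) ?_ (by positivity))
      (Real.sqrt_nonneg _))
    refine integral_mono_of_nonneg (Eventually.of_forall fun _ =>
      Real.rpow_nonneg (vNorm_nonneg _) _) (h.integrable_norm_mul_rpow hq _) ?_
    filter_upwards [h.posDef_right] with y hy
    refine Real.rpow_le_rpow (vNorm_nonneg _) ?_ hq.le
    rw [norm_mul_comm_of_isHermitian hA hy.isHermitian, Matrix.mulVec_mulVec]
    simpa [vNorm_single] using vNorm_mulVec_le (T y * A) (Pi.single j 1)
  simpa using Finset.sum_le_sum fun j (_ : j ∈ Finset.univ) => key j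

variable [IsProbabilityMeasure μ]

lemma IsDualPair.integrable_norm (h : IsDualPair μ p q S T) (hp : 1 ≤ p) :
    Integrable (fun x => ‖S x‖) μ :=
  (h.memLp_norm (zero_lt_one.trans_le hp)).integrable (by simpa using hp)

lemma IsDualPair.integrable_apply (h : IsDualPair μ p q S T) (hp : 1 ≤ p) (i j : Fin d) :
    Integrable (fun x => S x i j) μ :=
  (h.integrable_norm hp).mono' ((continuous_id.matrix_elem i j).comp_aestronglyMeasurable
    h.aesm_left) (Eventually.of_forall fun x => norm_apply_le_norm (S x) i j)

lemma IsDualPair.posDef_matIntegral (h : IsDualPair μ p q S T) (hp : 1 ≤ p) :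
    (matIntegral μ S).PosDef := by
  have hS := h.integrable_apply hp
  have hH : (matIntegral μ S).IsHermitian := by
    ext i j
    rw [Matrix.conjTranspose_apply, matIntegral, Matrix.of_apply, Matrix.of_apply, RCLike.star_def,
      ← integral_conj]
    refine integral_congr_ae ?_
    filter_upwards [h.posDef_left] with x hx
    exact hx.isHermitian.apply i j
  refine Matrix.PosDef.of_dotProduct_mulVec_pos hH fun e he => ?_
  have hre : 0 < (star e ⬝ᵥ matIntegral μ S *ᵥ e).re := by
    rw [re_dotProduct_matIntegral_mulVec hS]
    have hpos : ∀ᵐ x ∂μ, 0 < (star e ⬝ᵥ S x *ᵥ e).re := by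
      filter_upwards [h.posDef_left] with x hx
      exact hx.re_dotProduct_pos he
    have h0 : 0 ≤ᵐ[μ] fun x => (star e ⬝ᵥ S x *ᵥ e).re := hpos.mono fun x hx => hx.le
    refine (integral_nonneg_of_ae h0).lt_of_ne fun heq => ?_
    rw [eq_comm, integral_eq_zero_iff_of_nonneg_ae h0
      (integrable_dotProduct_mulVec hS (star e) e).re] at heq
    obtain ⟨x, hx, hx'⟩ := (hpos.and heq).exists
    exact hx.ne' hx'
  have him : (star e ⬝ᵥ matIntegral μ S *ᵥ e).im = 0 := hH.im_star_dotProduct_mulVec_self e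
  rw [Complex.lt_def]
  exact ⟨hre, him.symm⟩

lemma IsDualPair.one_le_norm_det_mul_norm_det (h : IsDualPair μ p q S T) (hp : 1 ≤ p)
    (hq : 1 ≤ q) :
    1 ≤ (d ! : ℝ) ^ 2 * (‖(matIntegral μ S).det‖ * ‖(matIntegral μ T).det‖) := by
  have hS := h.integrable_apply hp
  have hT := h.symm.integrable_apply hq
  refine TwoWeightBMO.one_le_norm_det_mul_norm_det (h.posDef_matIntegral hp)
    (h.symm.posDef_matIntegral hq) fun e f => ?_
  have iS : Integrable (fun x => (star e ⬝ᵥ S x *ᵥ e).re) μ :=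
    (integrable_dotProduct_mulVec hS _ _).re
  have iT : Integrable (fun x => (star f ⬝ᵥ T x *ᵥ f).re) μ :=
    (integrable_dotProduct_mulVec hT _ _).re
  rw [re_dotProduct_matIntegral_mulVec hS, re_dotProduct_matIntegral_mulVec hT,
    ← integral_add iS iT]
  calc 2 * (star e ⬝ᵥ f).re = ∫ _, 2 * (star e ⬝ᵥ f).re ∂μ := by simp
    _ ≤ _ := integral_mono_ae (integrable_const _) (iS.add iT) (by
        filter_upwards [h.posDef_left, h.posDef_right, h.mul_eq_one] with x h1 h2 h3
        exact two_mul_re_dotProduct_le h1 h2 h3 e f)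

lemma IsDualPair.vNorm_matIntegral_mulVec_le (h : IsDualPair μ p q S T)
    (hpq : p.HolderConjugate q) (hM : IsReducingFor μ p S M) (e : Fin d → ℂ) :
    vNorm d (matIntegral μ S *ᵥ e) ≤ vNorm d (M *ᵥ e) := by
  refine (TwoWeightBMO.vNorm_matIntegral_mulVec_le (h.integrable_apply hpq.lt.le) e).trans
    (le_trans ?_ (hM.2 e).1)
  have := integral_mul_le_Lp_mul_Lq_of_nonneg (μ := μ) hpq
    (f := fun x => vNorm d (S x *ᵥ e)) (g := fun _ => 1)
    (Eventually.of_forall fun _ => vNorm_nonneg _) (Eventually.of_forall fun _ => zero_le_one)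
    (h.memLp_vNorm hpq.pos e) (memLp_const _)
  simpa using this

lemma IsDualPair.norm_dotProduct_le (h : IsDualPair μ p q S T) (hpq : p.HolderConjugate q)
    (hM : IsReducingFor μ p S M) (hM' : IsReducingFor μ q T M') (e f : Fin d → ℂ) :
    ‖star e ⬝ᵥ f‖ ≤ vNorm d (M *ᵥ e) * vNorm d (M' *ᵥ f) := by
  have hH := integral_mul_le_Lp_mul_Lq_of_nonneg (μ := μ) hpq
    (f := fun x => vNorm d (S x *ᵥ e)) (g := fun x => vNorm d (T x *ᵥ f))
    (Eventually.of_forall fun _ => vNorm_nonneg _) (Eventually.of_forall fun _ => vNorm_nonneg _)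
    (h.memLp_vNorm hpq.pos e) (h.symm.memLp_vNorm hpq.symm.pos f)
  have hi : Integrable (fun x => vNorm d (S x *ᵥ e) * vNorm d (T x *ᵥ f)) μ := by
    have := hpq.ennrealOfReal
    exact (h.memLp_vNorm hpq.pos e).integrable_mul (h.symm.memLp_vNorm hpq.symm.pos f)
  calc ‖star e ⬝ᵥ f‖ = ∫ _, ‖star e ⬝ᵥ f‖ ∂μ := by simp
    _ ≤ ∫ x, vNorm d (S x *ᵥ e) * vNorm d (T x *ᵥ f) ∂μ := by
        refine integral_mono_ae (integrable_const _) hi ?_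
        filter_upwards [h.posDef_left, h.mul_eq_one] with x h1 h2
        have : star e ⬝ᵥ f = star (S x *ᵥ e) ⬝ᵥ (T x *ᵥ f) := by
          rw [Matrix.star_mulVec, h1.isHermitian.eq, ← Matrix.dotProduct_mulVec,
            Matrix.mulVec_mulVec, h2, Matrix.one_mulVec]
        rw [this]
        exact norm_star_dotProduct_le _ _
    _ ≤ _ := hH
    _ ≤ _ := mul_le_mul (hM.2 e).1 (hM'.2 f).1
        (Real.rpow_nonneg (integral_nonneg fun _ => Real.rpow_nonneg (vNorm_nonneg _) _) _)
        (vNorm_nonneg _)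

lemma IsDualPair.vNorm_inv_mulVec_le (h : IsDualPair μ p q S T) (hpq : p.HolderConjugate q)
    (hM : IsReducingFor μ p S M) (hM' : IsReducingFor μ q T M') (f : Fin d → ℂ) :
    vNorm d (M⁻¹ *ᵥ f) ≤ vNorm d (M' *ᵥ f) := by
  have hdet : IsUnit M.det := isUnit_iff_ne_zero.2 hM.1.det_pos.ne'
  have h1 := h.norm_dotProduct_le hpq hM hM' (M⁻¹ *ᵥ (M⁻¹ *ᵥ f)) f
  have h2 : star (M⁻¹ *ᵥ (M⁻¹ *ᵥ f)) ⬝ᵥ f = star (M⁻¹ *ᵥ f) ⬝ᵥ (M⁻¹ *ᵥ f) := by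
    rw [Matrix.star_mulVec, hM.1.inv.isHermitian.eq, ← Matrix.dotProduct_mulVec]
  rw [h2, Matrix.mulVec_mulVec _ M, Matrix.mul_nonsing_inv _ hdet, Matrix.one_mulVec] at h1
  have h3 : vNorm d (M⁻¹ *ᵥ f) ^ 2 ≤ vNorm d (M⁻¹ *ᵥ f) * vNorm d (M' *ᵥ f) := by
    rw [← re_star_dotProduct_self]
    exact (Complex.re_le_norm _).trans h1
  by_contra! hlt
  nlinarith [vNorm_nonneg (M' *ᵥ f), vNorm_nonneg (M⁻¹ *ᵥ f)]


lemma IsDualPair.integrable_integral_norm_mul_rpow (h : IsDualPair μ p q S T)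
    (hpq : p.HolderConjugate q) :
    Integrable (fun x => (∫ y, ‖S x * T y‖ ^ q ∂μ) ^ (p / q)) μ := by
  have hq := hpq.symm.pos
  have hpq0 : 0 ≤ p / q := div_nonneg hpq.nonneg hq.le
  have hm : AEStronglyMeasurable (fun z : X × X => ‖S z.1 * T z.2‖ ^ q) (μ.prod μ) :=
    (continuous_norm.rpow_const fun _ => Or.inr hq.le).comp_aestronglyMeasurable
      (h.aesm_left.comp_fst.mul h.aesm_right.comp_snd)
  refine (h.integrable_left.mul_const ((∫ y, ‖T y‖ ^ q ∂μ) ^ (p / q))).mono'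
    ((Real.continuous_rpow_const hpq0).comp_aestronglyMeasurable hm.integral_prod_right')
    (Eventually.of_forall fun x => ?_)
  have h0 : 0 ≤ ∫ y, ‖T y‖ ^ q ∂μ := integral_nonneg fun _ => by positivity
  have h1 : 0 ≤ ∫ y, ‖S x * T y‖ ^ q ∂μ := integral_nonneg fun _ => by positivity
  rw [Real.norm_of_nonneg (by positivity)]
  calc (∫ y, ‖S x * T y‖ ^ q ∂μ) ^ (p / q) ≤ (‖S x‖ ^ q * ∫ y, ‖T y‖ ^ q ∂μ) ^ (p / q) := by
        refine Real.rpow_le_rpow h1 ?_ hpq0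
        rw [← integral_const_mul]
        refine integral_mono (h.integrable_norm_mul_rpow hq _) (h.integrable_right.const_mul _)
          fun y => ?_
        simp only
        rw [← Real.mul_rpow (norm_nonneg _) (norm_nonneg _)]
        exact Real.rpow_le_rpow (norm_nonneg _) (norm_mul_le _ _) hq.le
    _ = ‖S x‖ ^ p * (∫ y, ‖T y‖ ^ q ∂μ) ^ (p / q) := by
        rw [Real.mul_rpow (by positivity) h0, ← Real.rpow_mul (norm_nonneg _),
          mul_div_cancel₀ _ hq.ne']

lemma IsDualPair.norm_mul_le (h : IsDualPair μ p q S T) (hpq : p.HolderConjugate q)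
    (hM : IsReducingFor μ p S M) (hM' : IsReducingFor μ q T M') :
    ‖M * M'‖ ≤ d ^ 2 * (∫ x, (∫ y, ‖S x * T y‖ ^ q ∂μ) ^ (p / q) ∂μ) ^ (1 / p) := by
  have hp := hpq.pos
  have hq := hpq.symm.pos
  set C := ∫ x, (∫ y, ‖S x * T y‖ ^ q ∂μ) ^ (p / q) ∂μ with hC
  have hC0 : 0 ≤ C := integral_integral_norm_mul_rpow_nonneg
  refine norm_le_of_vNorm_mulVec_le (by positivity) fun e => ?_
  have he := vNorm_nonneg e
  have hK : 0 ≤ (d : ℝ) * √d * vNorm d e := by positivity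
  have hint : ∫ x, vNorm d (S x *ᵥ M' *ᵥ e) ^ p ∂μ ≤ (d * √d * vNorm d e) ^ p * C := by
    rw [hC, ← integral_const_mul]
    refine integral_mono_of_nonneg (Eventually.of_forall fun _ =>
      Real.rpow_nonneg (vNorm_nonneg _) _)
      ((h.integrable_integral_norm_mul_rpow hpq).const_mul _) ?_
    filter_upwards [h.posDef_left] with x hx
    have hI : 0 ≤ ∫ y, ‖S x * T y‖ ^ q ∂μ := integral_nonneg fun _ => by positivity
    have hexp : (∫ y, ‖S x * T y‖ ^ q ∂μ) ^ (p / q) =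
        ((∫ y, ‖S x * T y‖ ^ q ∂μ) ^ (1 / q)) ^ p := by
      rw [← Real.rpow_mul hI]
      congr 1
      ring
    rw [hexp, ← Real.mul_rpow hK (by positivity), Matrix.mulVec_mulVec]
    refine Real.rpow_le_rpow (vNorm_nonneg _) ((vNorm_mulVec_le _ _).trans ?_) hp.le
    calc ‖S x * M'‖ * vNorm d e
        ≤ d * (√d * (∫ y, ‖S x * T y‖ ^ q ∂μ) ^ (1 / q)) * vNorm d e :=
          mul_le_mul_of_nonneg_right (h.norm_mul_le_integral hq hM' hx.isHermitian) he
      _ = _ := by ring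
  rw [← Matrix.mulVec_mulVec]
  calc vNorm d (M *ᵥ M' *ᵥ e)
      ≤ √d * (∫ x, vNorm d (S x *ᵥ M' *ᵥ e) ^ p ∂μ) ^ (1 / p) := (hM.2 _).2
    _ ≤ √d * ((d * √d * vNorm d e) ^ p * C) ^ (1 / p) := by
        refine mul_le_mul_of_nonneg_left (Real.rpow_le_rpow
          (integral_nonneg fun _ => Real.rpow_nonneg (vNorm_nonneg _) _) hint (by positivity))
          (Real.sqrt_nonneg _)
    _ = √d * (d * √d * vNorm d e * C ^ (1 / p)) := by
        rw [Real.mul_rpow (by positivity) hC0, ← Real.rpow_mul hK, mul_one_div_cancel hp.ne',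
          Real.rpow_one]
    _ = (√d * √d) * d * C ^ (1 / p) * vNorm d e := by ring
    _ = d ^ 2 * C ^ (1 / p) * vNorm d e := by
        rw [Real.mul_self_sqrt (Nat.cast_nonneg d)]
        ring

lemma IsDualPair.vNorm_mulVec_le (h : IsDualPair μ p q S T) (hpq : p.HolderConjugate q)
    (hM : IsReducingFor μ p S M) (hM' : IsReducingFor μ q T M') (e : Fin d → ℂ) :
    vNorm d (M' *ᵥ e) ≤
      d ^ 2 * (∫ x, (∫ y, ‖S x * T y‖ ^ q ∂μ) ^ (p / q) ∂μ) ^ (1 / p) * vNorm d (M⁻¹ *ᵥ e) := by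
  have hdet : IsUnit M.det := isUnit_iff_ne_zero.2 hM.1.det_pos.ne'
  have : M' *ᵥ e = (M' * M) *ᵥ M⁻¹ *ᵥ e := by
    rw [Matrix.mulVec_mulVec, Matrix.mul_assoc, Matrix.mul_nonsing_inv _ hdet, Matrix.mul_one]
  rw [this]
  refine (TwoWeightBMO.vNorm_mulVec_le _ _).trans
    (mul_le_mul_of_nonneg_right ?_ (vNorm_nonneg _))
  rw [norm_mul_comm_of_isHermitian hM'.1.isHermitian hM.1.isHermitian]
  exact h.norm_mul_le hpq hM hM'

lemma norm_det_le_of_norm_le {A : Matrix (Fin d) (Fin d) ℂ} {K : ℝ} (h : ‖A‖ ≤ K) :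
    ‖A.det‖ ≤ d ! * K ^ d :=
  norm_det_le_of_apply_le fun i j => (norm_apply_le_norm A i j).trans h

lemma norm_mul_inv_le_one {A M : Matrix (Fin d) (Fin d) ℂ} (hM : M.PosDef)
    (h : ∀ e, vNorm d (A *ᵥ e) ≤ vNorm d (M *ᵥ e)) : ‖A * M⁻¹‖ ≤ 1 := by
  have hdet : IsUnit M.det := isUnit_iff_ne_zero.2 hM.det_pos.ne'
  refine norm_le_of_vNorm_mulVec_le zero_le_one fun e => ?_
  simpa [Matrix.mulVec_mulVec, Matrix.mul_nonsing_inv _ hdet] using h (M⁻¹ *ᵥ e)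

lemma norm_det_le_of_vNorm_le {A M : Matrix (Fin d) (Fin d) ℂ} (hM : M.PosDef)
    (h : ∀ e, vNorm d (A *ᵥ e) ≤ vNorm d (M *ᵥ e)) : ‖A.det‖ ≤ d ! * ‖M.det‖ := by
  have hdet : IsUnit M.det := isUnit_iff_ne_zero.2 hM.det_pos.ne'
  have h1 := norm_det_le_of_norm_le (norm_mul_inv_le_one hM h)
  have h2 : A.det = (A * M⁻¹).det * M.det := by
    rw [← Matrix.det_mul, Matrix.mul_assoc, Matrix.nonsing_inv_mul _ hdet, Matrix.mul_one]
  rw [h2, norm_mul]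
  exact mul_le_mul_of_nonneg_right (by simpa using h1) (norm_nonneg _)

lemma norm_det_mul_vNorm_mulVec_le {A M : Matrix (Fin d) (Fin d) ℂ} (hM : M.PosDef)
    (h : ∀ e, vNorm d (A *ᵥ e) ≤ vNorm d (M *ᵥ e)) (e : Fin d → ℂ) :
    ‖A.det‖ * vNorm d (M *ᵥ e) ≤ d * (d * d !) * ‖M.det‖ * vNorm d (A *ᵥ e) := by
  have hdet : IsUnit M.det := isUnit_iff_ne_zero.2 hM.det_pos.ne'
  have h1 := norm_adjugate_le (norm_mul_inv_le_one hM h)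
  have h2 : A.det = M.det * (A * M⁻¹).det := by
    rw [← Matrix.det_mul, ← Matrix.det_mul_comm, Matrix.mul_assoc, Matrix.nonsing_inv_mul _ hdet,
      Matrix.mul_one]
  have h3 : A *ᵥ e = (A * M⁻¹) *ᵥ M *ᵥ e := by
    rw [Matrix.mulVec_mulVec, Matrix.mul_assoc, Matrix.nonsing_inv_mul _ hdet, Matrix.mul_one]
  have h4 : (A * M⁻¹).det • M *ᵥ e = (A * M⁻¹).adjugate *ᵥ A *ᵥ e := by
    rw [h3, Matrix.mulVec_mulVec _ (A * M⁻¹).adjugate, Matrix.adjugate_mul, Matrix.smul_mulVec,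
      Matrix.one_mulVec]
  calc ‖A.det‖ * vNorm d (M *ᵥ e) = ‖M.det‖ * vNorm d ((A * M⁻¹).det • M *ᵥ e) := by
        rw [vNorm_smul, h2, norm_mul, mul_assoc]
    _ ≤ ‖M.det‖ * (d * (d * d !) * vNorm d (A *ᵥ e)) := by
        rw [h4]
        exact mul_le_mul_of_nonneg_left ((TwoWeightBMO.vNorm_mulVec_le _ _).trans
          (mul_le_mul_of_nonneg_right h1 (vNorm_nonneg _))) (norm_nonneg _)
    _ = _ := by ring

lemma IsDualPair.vNorm_mulVec_le_matIntegral (h : IsDualPair μ p q S T)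
    (hpq : p.HolderConjugate q) (hM : IsReducingFor μ p S M) (hM' : IsReducingFor μ q T M')
    (e : Fin d → ℂ) :
    vNorm d (M *ᵥ e) ≤ (d ! : ℝ) ^ 2 * d ! * d ! * (d ^ 2) ^ d * (d * (d * d !)) *
      ((∫ x, (∫ y, ‖S x * T y‖ ^ q ∂μ) ^ (p / q) ∂μ) ^ (1 / p)) ^ d *
        vNorm d (matIntegral μ S *ᵥ e) := by
  set L := (∫ x, (∫ y, ‖S x * T y‖ ^ q ∂μ) ^ (p / q) ∂μ) ^ (1 / p)
  set A := matIntegral μ S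
  set B := matIntegral μ T
  have h1 := h.one_le_norm_det_mul_norm_det hpq.lt.le hpq.symm.lt.le
  have h2 := norm_det_mul_vNorm_mulVec_le hM.1 (h.vNorm_matIntegral_mulVec_le hpq hM) e
  have h3 := norm_det_le_of_vNorm_le hM'.1 (h.symm.vNorm_matIntegral_mulVec_le hpq.symm hM')
  have h4 := norm_det_le_of_norm_le (h.norm_mul_le hpq hM hM')
  rw [Matrix.det_mul, norm_mul] at h4
  have hMe := vNorm_nonneg (M *ᵥ e)
  have hAe := vNorm_nonneg (A *ᵥ e)
  calc vNorm d (M *ᵥ e) ≤ (d ! : ℝ) ^ 2 * (‖A.det‖ * ‖B.det‖) * vNorm d (M *ᵥ e) :=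
        le_mul_of_one_le_left hMe h1
    _ = (d ! : ℝ) ^ 2 * ‖B.det‖ * (‖A.det‖ * vNorm d (M *ᵥ e)) := by ring
    _ ≤ (d ! : ℝ) ^ 2 * (d ! * ‖M'.det‖) *
        (d * (d * d !) * ‖M.det‖ * vNorm d (A *ᵥ e)) := by gcongr
    _ = (d ! : ℝ) ^ 2 * d ! * (d * (d * d !)) * (‖M.det‖ * ‖M'.det‖) * vNorm d (A *ᵥ e) := by ring
    _ ≤ (d ! : ℝ) ^ 2 * d ! * (d * (d * d !)) * (d ! * (d ^ 2 * L) ^ d) * vNorm d (A *ᵥ e) := by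
        gcongr
    _ = _ := by ring

end DualPair

section Average

variable {d : ℕ} {X : Type*} [MeasurableSpace X] {μ : Measure X} {p : ℝ}

lemma IsReducingFor.congr {S T : X → Matrix (Fin d) (Fin d) ℂ} {M : Matrix (Fin d) (Fin d) ℂ}
    (hST : S =ᵐ[μ] T) (h : IsReducingFor μ p S M) : IsReducingFor μ p T M := by
  refine ⟨h.1, fun e => ?_⟩
  have : ∫ x, vNorm d (T x *ᵥ e) ^ p ∂μ = ∫ x, vNorm d (S x *ᵥ e) ^ p ∂μ := by
    refine integral_congr_ae ?_
    filter_upwards [hST] with x hx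
    rw [hx]
  rw [this]
  exact h.2 e

lemma matRpow_matRpow_neg_pconj {A : Matrix (Fin d) (Fin d) ℂ} (hA : A.PosDef) (hp : 1 < p) :
    matRpow (matRpow A (-(1 / (p - 1)))) (1 / pconj p) = matRpow A (-(1 / p)) := by
  have : p - 1 ≠ 0 := by linarith
  have : p ≠ 0 := by linarith
  rw [matRpow_matRpow hA, pconj]
  congr 1
  field_simp

lemma isDualPair_matRpow {W : X → Matrix (Fin d) (Fin d) ℂ} (hp : 1 < p)
    (hW : ∀ᵐ x ∂μ, (W x).PosDef) (hm : ∀ i j, AEStronglyMeasurable (fun x => W x i j) μ)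
    (hi : Integrable (fun x => mNorm d (W x)) μ)
    (hi' : Integrable (fun x => mNorm d (matRpow (W x) (-(1 / (p - 1))))) μ) :
    IsDualPair μ p (pconj p) (fun x => matRpow (W x) (1 / p))
      fun x => matRpow (W x) (-(1 / p)) := by
  have hpq : p.HolderConjugate (pconj p) := (Real.holderConjugate_iff_eq_conjExponent hp).2 rfl
  have hS := aestronglyMeasurable_matRpow hW hm (1 / p)
  have hT := aestronglyMeasurable_matRpow hW hm (-(1 / p))
  refine ⟨hW.mono fun x hx => posDef_matRpow hx _, hW.mono fun x hx => posDef_matRpow hx _,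
    hW.mono fun x hx => matRpow_mul_matRpow_neg hx _, hS, hT, ?_, ?_⟩
  · refine hi.mono' ((continuous_norm.rpow_const fun _ =>
      Or.inr hpq.nonneg).comp_aestronglyMeasurable hS) ?_
    filter_upwards [hW] with x hx
    rw [Real.norm_of_nonneg (by positivity)]
    exact norm_matRpow_one_div_rpow_le hx hpq.pos
  · refine hi'.mono' ((continuous_norm.rpow_const fun _ =>
      Or.inr hpq.symm.nonneg).comp_aestronglyMeasurable hT) ?_
    filter_upwards [hW] with x hx
    rw [Real.norm_of_nonneg (by positivity), ← matRpow_matRpow_neg_pconj hx hp]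
    exact norm_matRpow_one_div_rpow_le (posDef_matRpow hx _) hpq.symm.pos

end Average

/-- (Properties of reducing operators.) Let `E ⊆ ℝ^N` be bounded and
measurable with positive measure, `W` a.e. positive definite with `W` and
`W' = W^{-1/(p-1)}` integrable over `E`, and `C_E` the localized `A_p` quantity. Then for
reducing operators `𝒲_E` (of `W`, w.r.t. `p`) and `𝒲'_E` (of `W'`, w.r.t. `p'`):
(1) `|𝒲_E^{-1} e| ≤ |𝒲'_E e| ≤ c_{p,d} C_E^{1/p} |𝒲_E^{-1} e|` and
(2) `|⟨W^{1/p}⟩_E e| ≤ |𝒲_E e| ≤ c'_{p,d} C_E^{d/p} |⟨W^{1/p}⟩_E e|` for all `e ∈ ℂ^d`. -/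
theorem reducing_operator_properties (d : ℕ) (p : ℝ) (hp : 1 < p) :
    ∃ c c' : ℝ, 0 < c ∧ 0 < c' ∧
      ∀ (N : ℕ) (E : Set (Fin N → ℝ)),
        MeasurableSet E → Bornology.IsBounded E → 0 < volume E →
        ∀ W : (Fin N → ℝ) → Matrix (Fin d) (Fin d) ℂ,
          (∀ᵐ x ∂volume.restrict E, (W x).PosDef) →
          (∀ i j, AEStronglyMeasurable (fun x => W x i j) (volume.restrict E)) →
          IntegrableOn (fun x => mNorm d (W x)) E →
          IntegrableOn (fun x => mNorm d (matRpow (W x) (-(1 / (p - 1))))) E →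
          ∀ ME ME' : Matrix (Fin d) (Fin d) ℂ,
            IsReducing p W E ME →
            IsReducing (pconj p) (fun x => matRpow (W x) (-(1 / (p - 1)))) E ME' →
            ∀ e : Fin d → ℂ,
              (vNorm d (ME⁻¹.mulVec e) ≤ vNorm d (ME'.mulVec e) ∧
                vNorm d (ME'.mulVec e)
                  ≤ c * apQ p W E ^ (1 / p) * vNorm d (ME⁻¹.mulVec e)) ∧
              (vNorm d ((matAvg (fun x => matRpow (W x) (1 / p)) E).mulVec e)
                  ≤ vNorm d (ME.mulVec e) ∧
                vNorm d (ME.mulVec e)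
                  ≤ c' * apQ p W E ^ ((d : ℝ) / p) *
                      vNorm d ((matAvg (fun x => matRpow (W x) (1 / p)) E).mulVec e)) := by
  have hpq : p.HolderConjugate (pconj p) := (Real.holderConjugate_iff_eq_conjExponent hp).2 rfl
  have hp0 : 0 < p := hpq.pos
  refine ⟨(d : ℝ) ^ 2 + 1, (d ! : ℝ) ^ 2 * d ! * d ! * (d ^ 2) ^ d * (d * (d * d !)) + 1,
    by positivity, by positivity, ?_⟩
  intro N E _ hEb hE0 W hW hWm hWi hWi' ME ME' hME hME' e
  set ν := volume.restrict E with hν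
  set μ := (ν Set.univ)⁻¹ • ν with hμ
  have hν0 : ν Set.univ ≠ 0 := by simpa [hν] using hE0.ne'
  have hνt : ν Set.univ ≠ ∞ := by simpa [hν] using hEb.measure_lt_top.ne
  have : IsFiniteMeasure ν := ⟨hνt.lt_top⟩
  have : NeZero ν := ⟨fun h => hν0 (by simp [h])⟩
  have : IsProbabilityMeasure μ := isProbabilityMeasureSMul
  have hac : μ ≪ ν := Measure.smul_absolutelyContinuous
  have hpair : IsDualPair μ p (pconj p) (fun x => matRpow (W x) (1 / p))
      fun x => matRpow (W x) (-(1 / p)) :=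
    isDualPair_matRpow hp (hac.ae_le hW) (fun i j => (hWm i j).mono_ac hac)
      (hWi.smul_measure (ENNReal.inv_ne_top.2 hν0)) (hWi'.smul_measure (ENNReal.inv_ne_top.2 hν0))
  have hM : IsReducingFor μ p (fun x => matRpow (W x) (1 / p)) ME := hME
  have hM' : IsReducingFor μ (pconj p) (fun x => matRpow (W x) (-(1 / p))) ME' := by
    refine IsReducingFor.congr ?_ (show IsReducingFor μ (pconj p)
      (fun x => matRpow (matRpow (W x) (-(1 / (p - 1)))) (1 / pconj p)) ME' from hME')
    filter_upwards [hac.ae_le hW] with x hx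
    exact matRpow_matRpow_neg_pconj hx hp
  have hC : apQ p W E =
      ∫ x, (∫ y, ‖matRpow (W x) (1 / p) * matRpow (W y) (-(1 / p))‖ ^ pconj p ∂μ) ^
        (p / pconj p) ∂μ := rfl
  have hC0 : 0 ≤ apQ p W E := hC ▸ integral_integral_norm_mul_rpow_nonneg
  have hCd : apQ p W E ^ ((d : ℝ) / p) = (apQ p W E ^ (1 / p)) ^ d := by
    rw [← Real.rpow_natCast, ← Real.rpow_mul hC0]
    congr 1
    ring
  refine ⟨⟨hpair.vNorm_inv_mulVec_le hpq hM hM' e,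
    (hpair.vNorm_mulVec_le hpq hM hM' e).trans ?_⟩,
    hpair.vNorm_matIntegral_mulVec_le hpq hM e,
    (hpair.vNorm_mulVec_le_matIntegral hpq hM hM' e).trans ?_⟩
  · rw [← hC]
    have := vNorm_nonneg (ME⁻¹ *ᵥ e)
    gcongr
    linarith
  · rw [← hC, hCd]
    have := vNorm_nonneg (matIntegral μ (fun x => matRpow (W x) (1 / p)) *ᵥ e)
    change _ ≤ _ * _ * vNorm d (matIntegral μ (fun x => matRpow (W x) (1 / p)) *ᵥ e)
    gcongr
    linarith

end TwoWeightBMO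
end
end
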